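/- arXiv:1511.07044 — 2 statements merged into one kernel-verified Lean document; each statement's English description precedes it below -/
import Mathlib

section
/- Let d ≥ 3 and let p be a binary form of degree d that is a product of d pairwise non-proportional real linear forms (a hyperbolic form with distinct roots). For a binary form q of degree d with q ∉ ℝ·p, define ρ(q) = min{ rank_ℝ(q + μ·p) : μ ∈ ℝ } (the real rank of the image of q with respect to the projection of the rational normal curve from p). Call a natural number r typical if the set { q : q ∉ ℝ·p and ρ(q) = r } has nonempty interior in the space of degree-d binary forms with the Euclidean topology. Then: (i) ρ(q) ≤ d for every q ∉ ℝ·p; (ii) ⌈d/2⌉ is typical and no r < ⌈d/2⌉ is typical (the minimal typical rank is ⌈d/2⌉); and (iii) d is typical (the maximal typical rank is d). -/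
open scoped BigOperators
open MvPolynomial

/-- The real Waring rank of a binary form `f` of degree `d`: the least `r : ℕ∞` such that
`f = ∑ λᵢ ℓᵢ^d` for real numbers `λᵢ` and real linear forms `ℓᵢ` (`∞` if none exists). -/
noncomputable def waringRank (d : ℕ) (f : MvPolynomial (Fin 2) ℝ) : ℕ∞ :=
  sInf ((fun n : ℕ => (n : ℕ∞)) ''
    {r : ℕ | ∃ lam : Fin r → ℝ, ∃ l : Fin r → ℝ × ℝ,
      f = ∑ i, C (lam i) * (C (l i).1 * X 0 + C (l i).2 * X 1) ^ d})

/-- The real rank of (the image of) `q` with respect to the projection of the rational normal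
curve from the point `p`: the minimum over `μ ∈ ℝ` of the real Waring rank of `q + μ p`. -/
noncomputable def projRank (d : ℕ) (p q : MvPolynomial (Fin 2) ℝ) : ℕ∞ :=
  ⨅ μ : ℝ, waringRank d (q + μ • p)

/-- The binary form of degree `d` with coefficient vector `c`. -/
noncomputable def toForm (d : ℕ) (c : Fin (d + 1) → ℝ) : MvPolynomial (Fin 2) ℝ :=
  ∑ i : Fin (d + 1), C (c i) * X 0 ^ (i : ℕ) * X 1 ^ (d - (i : ℕ))

/-- `r` is a typical rank for the projection of the rational normal curve from `p` if the set
of (coefficient vectors of) degree-`d` binary forms `q ∉ ℝ·p` with `ρ(q) = r` has nonempty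
interior in the Euclidean topology. -/
def TypicalRank (d : ℕ) (p : MvPolynomial (Fin 2) ℝ) (r : ℕ∞) : Prop :=
  (interior {c : Fin (d + 1) → ℝ |
    (¬ ∃ μ : ℝ, toForm d c = μ • p) ∧ projRank d p (toForm d c) = r}).Nonempty

/-- `f` is a linear combination of `r` powers `ℓᵢ^d` of real linear forms. -/
def IsPowerSum (d r : ℕ) (f : MvPolynomial (Fin 2) ℝ) : Prop :=
  ∃ lam : Fin r → ℝ, ∃ l : Fin r → ℝ × ℝ,
    f = ∑ i, C (lam i) * (C (l i).1 * X 0 + C (l i).2 * X 1) ^ d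

lemma projRank_lt_iff {d : ℕ} {p q : MvPolynomial (Fin 2) ℝ} {n : ℕ∞} :
    projRank d p q < n ↔ ∃ r : ℕ, (r : ℕ∞) < n ∧ ∃ μ : ℝ, IsPowerSum d r (q + μ • p) := by
  unfold projRank waringRank IsPowerSum
  simp only [iInf_lt_iff, sInf_lt_iff, Set.mem_image, Set.mem_ofPred_eq]
  constructor
  · rintro ⟨μ, _, ⟨r, h, rfl⟩, hr⟩
    exact ⟨r, hr, μ, h⟩
  · rintro ⟨r, hr, μ, h⟩
    exact ⟨μ, _, ⟨r, h, rfl⟩, hr⟩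

lemma projRank_le {d r : ℕ} {p q : MvPolynomial (Fin 2) ℝ} {μ : ℝ}
    (h : IsPowerSum d r (q + μ • p)) : projRank d p q ≤ r :=
  (iInf_le _ μ).trans (sInf_le ⟨r, h, rfl⟩)

lemma IsPowerSum.mono {d r s : ℕ} {f : MvPolynomial (Fin 2) ℝ} (h : IsPowerSum d r f)
    (hrs : r ≤ s) : IsPowerSum d s f := by
  obtain ⟨k, rfl⟩ := Nat.exists_eq_add_of_le hrs
  obtain ⟨lam, l, rfl⟩ := h
  refine ⟨Fin.append lam 0, Fin.append l 0, ?_⟩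
  simp [Fin.sum_univ_add]

lemma toForm_add (d : ℕ) (c c' : Fin (d + 1) → ℝ) :
    toForm d (c + c') = toForm d c + toForm d c' := by
  simp [toForm, add_mul, Finset.sum_add_distrib]

lemma toForm_smul (d : ℕ) (a : ℝ) (c : Fin (d + 1) → ℝ) :
    toForm d (a • c) = a • toForm d c := by
  simp [toForm, Finset.smul_sum, smul_eq_C_mul, mul_assoc]

lemma toForm_sum (d : ℕ) {ι : Type*} (s : Finset ι) (c : ι → Fin (d + 1) → ℝ) :
    toForm d (∑ i ∈ s, c i) = ∑ i ∈ s, toForm d (c i) := by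
  classical
  induction s using Finset.induction_on with
  | empty => simp [toForm]
  | insert a s ha ih => rw [Finset.sum_insert ha, Finset.sum_insert ha, toForm_add, ih]

lemma eval_toForm (d : ℕ) (c : Fin (d + 1) → ℝ) (v : Fin 2 → ℝ) :
    eval v (toForm d c) = ∑ k : Fin (d + 1), c k * v 0 ^ (k : ℕ) * v 1 ^ (d - (k : ℕ)) := by
  simp [toForm]

lemma toForm_injective (d : ℕ) : Function.Injective (toForm d) := by
  intro c c' h
  have key : ∀ e : Fin (d + 1) → ℝ, aeval ![Polynomial.X, (1 : Polynomial ℝ)] (toForm d e) = 0 →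
      e = 0 := by
    intro e he
    funext k
    have := congrArg (fun P => Polynomial.coeff P (k : ℕ)) he
    simp only [toForm, map_sum, map_mul, map_pow, aeval_X, aeval_C, Polynomial.finsetSum_coeff]
      at this
    simpa [Polynomial.coeff_X_pow, Fin.val_inj] using this
  have h2 : toForm d (c + (-1 : ℝ) • c') = 0 := by
    rw [toForm_add, toForm_smul, h]; simp
  have := key _ (by rw [h2]; simp)
  have h3 : c - c' = 0 := by simpa [sub_eq_add_neg] using this
  exact sub_eq_zero.mp h3

lemma exists_toForm {d : ℕ} {f : MvPolynomial (Fin 2) ℝ} (hf : f.IsHomogeneous d) :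
    ∃ c, f = toForm d c := by
  classical
  refine ⟨fun k => coeff (Finsupp.single 0 (k : ℕ) + Finsupp.single 1 (d - (k : ℕ))) f, ?_⟩
  have hmon : ∀ k : ℕ, ∀ a : ℝ, C a * X 0 ^ k * X 1 ^ (d - k) =
      (monomial (Finsupp.single 0 k + Finsupp.single 1 (d - k)) a : MvPolynomial (Fin 2) ℝ) := by
    intro k a
    rw [X_pow_eq_monomial, X_pow_eq_monomial, C_mul_monomial, monomial_mul]
    simp
  ext m
  simp only [toForm, hmon, coeff_sum, coeff_monomial]
  by_cases hm : m.degree = d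
  · have hm2 : m 0 + m 1 = d := by
      rw [← hm, Finsupp.degree_eq_sum]; simp
    have hms : ∀ k : Fin (d + 1), (Finsupp.single 0 (k : ℕ) + Finsupp.single 1 (d - (k : ℕ)) = m)
        ↔ k = ⟨m 0, by omega⟩ := by
      intro k
      constructor
      · intro h
        ext
        simp [← h]
      · rintro rfl
        ext i
        fin_cases i
        · simp
        · simp; omega
    simp only [hms]
    simp only [Finset.sum_ite_eq', Finset.mem_univ, if_true]
    congr 1
    exact ((hms ⟨m 0, by omega⟩).2 rfl).symm
  · rw [hf.coeff_eq_zero hm, Finset.sum_eq_zero]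
    intro k _
    rw [if_neg]
    rintro rfl
    apply hm
    have := k.2
    simp [Finsupp.degree_eq_sum]
    omega

lemma isHomogeneous_linear (a b : ℝ) :
    (C a * X 0 + C b * X 1 : MvPolynomial (Fin 2) ℝ).IsHomogeneous 1 :=
  (isHomogeneous_C_mul_X a 0).add (isHomogeneous_C_mul_X b 1)

lemma C_mul_linear_pow (d : ℕ) (t a b : ℝ) :
    C t * (C a * X 0 + C b * X 1) ^ d =
      toForm d fun k => t * d.choose k * a ^ (k : ℕ) * b ^ (d - (k : ℕ)) := by
  rw [add_pow, ← Fin.sum_univ_eq_sum_range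
    (fun k => (C a * X 0) ^ k * (C b * X 1) ^ (d - k) * (d.choose k : MvPolynomial (Fin 2) ℝ)),
    Finset.mul_sum]
  refine Finset.sum_congr rfl fun k _ => ?_
  simp only [mul_pow, map_mul, map_pow, map_natCast]
  ring

lemma toForm_isPowerSum {d r : ℕ} {c : Fin (d + 1) → ℝ} (lam t : Fin r → ℝ)
    (h : ∀ k, c k = ∑ i, lam i * d.choose k * t i ^ (k : ℕ)) : IsPowerSum d r (toForm d c) := by
  refine ⟨lam, fun i => (t i, 1), ?_⟩
  simp only [C_mul_linear_pow, ← toForm_sum]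
  congr 1
  funext k
  simp [h, Finset.sum_apply]

lemma linear_form_cross {a b : ℝ × ℝ} (hb : b ≠ 0) (h : ¬ ∃ t : ℝ, a = t • b) :
    a.1 * b.2 - a.2 * b.1 ≠ 0 := by
  intro h0
  have hn : b.1 ^ 2 + b.2 ^ 2 ≠ 0 := by
    intro hs
    apply hb
    have h1 : b.1 = 0 := by nlinarith [sq_nonneg b.1, sq_nonneg b.2]
    have h2 : b.2 = 0 := by nlinarith [sq_nonneg b.1, sq_nonneg b.2]
    exact Prod.ext h1 h2
  refine h ⟨(a.1 * b.1 + a.2 * b.2) / (b.1 ^ 2 + b.2 ^ 2), ?_⟩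
  ext
  · simp only [Prod.smul_fst, smul_eq_mul]
    field_simp
    linear_combination b.2 * h0
  · simp only [Prod.smul_snd, smul_eq_mul]
    field_simp
    linear_combination -b.1 * h0

section Quadrature

lemma exists_polynomial_eval_eq (L : Polynomial ℝ →ₗ[ℝ] ℝ) (B : Polynomial (Polynomial ℝ)) :
    ∃ R : Polynomial ℝ, ∀ ε : ℝ, R.eval ε = L (B.eval (Polynomial.C ε)) := by
  refine ⟨∑ j ∈ Finset.range (B.natDegree + 1), Polynomial.C (L (B.coeff j)) * Polynomial.X ^ j,
    fun ε => ?_⟩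
  rw [Polynomial.eval_finsetSum, Polynomial.eval_eq_sum_range, map_sum]
  refine Finset.sum_congr rfl fun j _ => ?_
  have : B.coeff j * Polynomial.C ε ^ j = ε ^ j • B.coeff j := by
    rw [Polynomial.smul_eq_C_mul, map_pow, mul_comm]
  rw [this, map_smul, Polynomial.eval_mul, Polynomial.eval_pow, Polynomial.eval_C,
    Polynomial.eval_X, smul_eq_mul, mul_comm]

lemma exists_polynomial_eval_pow (L : Polynomial ℝ →ₗ[ℝ] ℝ) {n k : ℕ} (hk : k ≤ n)
    (hL : L (Polynomial.X ^ k) ≠ 0) :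
    ∃ R : Polynomial ℝ, R ≠ 0 ∧
      ∀ s : ℝ, R.eval s = L ((Polynomial.X + Polynomial.C s) ^ n) := by
  refine ⟨∑ j ∈ Finset.range (n + 1), Polynomial.C (L (Polynomial.X ^ j) * n.choose j) *
    Polynomial.X ^ (n - j), ?_, fun s => ?_⟩
  · intro h
    have := congrArg (fun P => Polynomial.coeff P (n - k)) h
    simp only [Polynomial.finsetSum_coeff, Polynomial.coeff_C_mul, Polynomial.coeff_X_pow,
      Polynomial.coeff_zero] at this
    rw [Finset.sum_eq_single k] at this
    · have hc : (n.choose k : ℝ) ≠ 0 := by exact_mod_cast (Nat.choose_pos hk).ne'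
      simp [hL, hc] at this
    · intro j hj hjk
      have := Finset.mem_range.1 hj
      rw [if_neg (by omega), mul_zero]
    · intro h; simp at h; omega
  · rw [Polynomial.eval_finsetSum, add_pow, map_sum]
    refine Finset.sum_congr rfl fun j _ => ?_
    have : Polynomial.X ^ j * Polynomial.C s ^ (n - j) * (n.choose j : Polynomial ℝ) =
        (s ^ (n - j) * n.choose j) • (Polynomial.X ^ j) := by
      rw [Polynomial.smul_eq_C_mul]
      simp only [map_mul, map_pow, map_natCast]
      ring
    rw [this, map_smul]
    simp
    ring

lemma quadrature_of_prod_eq_zero (L : Polynomial ℝ →ₗ[ℝ] ℝ) {d : ℕ} {y : Fin d → ℝ}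
    (hy : Function.Injective y) (h : L (∏ i, (Polynomial.X - Polynomial.C (y i))) = 0) :
    ∃ lam : Fin d → ℝ, ∀ k ≤ d, L (Polynomial.X ^ k) = ∑ i, lam i * y i ^ k := by
  refine ⟨fun i => L (Lagrange.basis Finset.univ y i), ?_⟩
  have key : ∀ P : Polynomial ℝ, P.degree < d →
      L P = ∑ i, L (Lagrange.basis Finset.univ y i) * P.eval (y i) := by
    intro P hP
    have h1 := Lagrange.eq_interpolate (s := Finset.univ) (v := y) (f := P) hy.injOn (by simpa)
    conv_lhs => rw [h1, Lagrange.interpolate_apply, map_sum]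
    refine Finset.sum_congr rfl fun i _ => ?_
    rw [← Polynomial.smul_eq_C_mul, map_smul, smul_eq_mul, mul_comm]
  intro k hk
  rcases hk.lt_or_eq with hk | rfl
  · rw [key _ (by rw [Polynomial.degree_X_pow]; exact_mod_cast hk)]
    simp
  · set N : Polynomial ℝ := ∏ i, (Polynomial.X - Polynomial.C (y i)) with hN
    have hNm : N.Monic := Polynomial.monic_prod_of_monic _ _ fun i _ => Polynomial.monic_X_sub_C _
    have hNd : N.degree = k := by
      rw [hN, Polynomial.degree_prod]; simp
    have hd : (Polynomial.X ^ k - N).degree < (k : WithBot ℕ) := by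
      have := Polynomial.degree_sub_lt_left (p := Polynomial.X ^ k) (q := N) (by simp [hNd])
        (by simp) (by simp [hNm.leadingCoeff])
      simpa using this
    have h2 := key _ hd
    rw [map_sub, h, sub_zero] at h2
    rw [h2]
    refine Finset.sum_congr rfl fun i _ => ?_
    have : N.eval (y i) = 0 := by
      rw [hN, Polynomial.eval_prod]
      exact Finset.prod_eq_zero (Finset.mem_univ i) (by simp)
    simp [this]

lemma exists_nodes (L : Polynomial ℝ →ₗ[ℝ] ℝ) {n k : ℕ} (hk : k ≤ n)
    (hL : L (Polynomial.X ^ k) ≠ 0) :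
    ∃ y : Fin (n + 1) → ℝ, Function.Injective y ∧
      L (∏ i, (Polynomial.X - Polynomial.C (y i))) = 0 := by
  obtain ⟨R₁, hR₁, h₁⟩ := exists_polynomial_eval_pow L hk hL
  obtain ⟨R₂, hR₂, h₂⟩ := exists_polynomial_eval_pow L (hk.trans n.le_succ) hL
  obtain ⟨s, hs⟩ : ∃ s, (R₁ * R₂).eval s ≠ 0 := by
    by_contra! h
    exact mul_ne_zero hR₁ hR₂ (Polynomial.funext (by simpa using h))
  rw [Polynomial.eval_mul, h₁, h₂] at hs
  have hs1 := left_ne_zero_of_mul hs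
  have hs2 := right_ne_zero_of_mul hs
  let x : ℝ → Fin n → ℝ := fun ε i => s + ε * (i : ℕ)
  let A : ℝ → Polynomial ℝ := fun ε => ∏ i, (Polynomial.X + Polynomial.C (x ε i))
  let b : Fin n → Polynomial (Polynomial ℝ) := fun i => Polynomial.C (Polynomial.X + Polynomial.C s)
    + Polynomial.X * Polynomial.C (Polynomial.C ((i : ℕ) : ℝ))
  have hb : ∀ ε i, (b i).eval (Polynomial.C ε) = Polynomial.X + Polynomial.C (x ε i) := by
    intro ε i
    simp only [b, x, Polynomial.eval_add, Polynomial.eval_C, Polynomial.eval_mul,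
      Polynomial.eval_X, map_add, map_mul]
    ring
  obtain ⟨S, hS⟩ := exists_polynomial_eval_eq L (∏ i, b i)
  choose T hT using fun i => exists_polynomial_eval_eq L ((∏ i, b i) * b i)
  simp only [Polynomial.eval_mul, Polynomial.eval_prod, hb] at hS hT
  have hA0 : ∏ i, (Polynomial.X + Polynomial.C (x 0 i)) =
      (Polynomial.X + Polynomial.C s) ^ n := by simp [x]
  have hS0 : S ≠ 0 := by
    rintro rfl
    apply hs1
    rw [← hA0, ← hS]; simp
  have hT0 : ∀ i, T i ≠ 0 := by
    intro i hi
    apply hs2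
    have h := hT i 0
    rw [hi, hA0] at h
    have hx : x 0 i = s := by simp [x]
    rw [hx, ← pow_succ] at h
    rw [← h]; simp
  obtain ⟨ε, hε⟩ : ∃ ε, (Polynomial.X * (S * ∏ i, T i)).eval ε ≠ 0 := by
    by_contra! h
    exact mul_ne_zero Polynomial.X_ne_zero (mul_ne_zero hS0 (Finset.prod_ne_zero_iff.2
      fun i _ => hT0 i)) (Polynomial.funext (by simpa using h))
  simp only [Polynomial.eval_mul, Polynomial.eval_X, Polynomial.eval_prod, hS, hT] at hε
  have hε0 := left_ne_zero_of_mul hε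
  have hLA : L (A ε) ≠ 0 := left_ne_zero_of_mul (right_ne_zero_of_mul hε)
  have hLT : ∀ i, L (A ε * (Polynomial.X + Polynomial.C (x ε i))) ≠ 0 := fun i =>
    Finset.prod_ne_zero_iff.1 (right_ne_zero_of_mul (right_ne_zero_of_mul hε)) i (Finset.mem_univ i)
  have hlin : ∀ τ, L (A ε * (Polynomial.X + Polynomial.C τ)) =
      L (A ε * Polynomial.X) + τ * L (A ε) := by
    intro τ
    rw [mul_add, map_add, mul_comm (A ε) (Polynomial.C τ), ← Polynomial.smul_eq_C_mul, map_smul,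
      smul_eq_mul]
  set τ := -L (A ε * Polynomial.X) / L (A ε) with hτ
  have hτ0 : L (A ε * (Polynomial.X + Polynomial.C τ)) = 0 := by
    rw [hlin, hτ]; field_simp; ring
  refine ⟨Fin.snoc (fun i => -x ε i) (-τ), ?_, ?_⟩
  · rw [Fin.snoc_injective_iff]
    refine ⟨fun i j hij => ?_, ?_⟩
    · have : ε * (i : ℕ) = ε * (j : ℕ) := by simpa [x] using hij
      exact Fin.ext (by exact_mod_cast mul_left_cancel₀ hε0 this)
    · rintro ⟨i, hi⟩
      apply hLT i
      rw [neg_inj.1 hi, hτ0]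
  · rw [Fin.prod_univ_castSucc]
    simpa [A] using hτ0

/-- Any functional on polynomials of degree `≤ d` sends `X ^ k` to the scaled coefficients of a
binary form; powers of linear forms correspond to evaluations. -/
noncomputable def apolarFunctional (d : ℕ) (c : Fin (d + 1) → ℝ) : Polynomial ℝ →ₗ[ℝ] ℝ :=
  ∑ k : Fin (d + 1), (c k / d.choose k) • Polynomial.lcoeff ℝ k

lemma apolarFunctional_X_pow {d : ℕ} (c : Fin (d + 1) → ℝ) (k : Fin (d + 1)) :
    apolarFunctional d c (Polynomial.X ^ (k : ℕ)) = c k / d.choose k := by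
  simp [apolarFunctional, Polynomial.coeff_X_pow, Fin.val_inj]

lemma choose_ne_zero_real {d : ℕ} (k : Fin (d + 1)) : (d.choose k : ℝ) ≠ 0 := by
  exact_mod_cast (Nat.choose_pos (Nat.lt_succ_iff.1 k.2)).ne'

lemma isPowerSum_toForm_self {d : ℕ} (hd : 1 ≤ d) (c : Fin (d + 1) → ℝ) :
    IsPowerSum d d (toForm d c) := by
  by_cases h : ∃ k : Fin (d + 1), (k : ℕ) < d ∧ c k ≠ 0
  · obtain ⟨k, hkd, hk⟩ := h
    obtain ⟨n, rfl⟩ := Nat.exists_eq_add_of_le' hd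
    have hL : apolarFunctional (n + 1) c (Polynomial.X ^ (k : ℕ)) ≠ 0 := by
      rw [apolarFunctional_X_pow]
      exact div_ne_zero hk (choose_ne_zero_real k)
    obtain ⟨y, hy, hy0⟩ := exists_nodes _ (Nat.lt_succ_iff.1 hkd) hL
    obtain ⟨lam, hlam⟩ := quadrature_of_prod_eq_zero _ hy hy0
    refine toForm_isPowerSum lam y fun j => ?_
    have := hlam j (Nat.lt_succ_iff.1 j.2)
    rw [apolarFunctional_X_pow, div_eq_iff (choose_ne_zero_real j)] at this
    rw [this, Finset.sum_mul]
    exact Finset.sum_congr rfl fun i _ => by ring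
  · push Not at h
    refine IsPowerSum.mono (r := 1) ⟨fun _ => c (Fin.last d), fun _ => (1, 0), ?_⟩ hd
    simp only [C_mul_linear_pow, ← toForm_sum]
    congr 1
    funext k
    rcases (Nat.lt_succ_iff.1 k.2).lt_or_eq with hk | hk
    · have : d - (k : ℕ) ≠ 0 := by omega
      simp [h k hk, this]
    · have : k = Fin.last d := Fin.ext hk
      subst this
      simp

end Quadrature

/-- A sum of fewer than `n` powers `ℓₖ^n` which vanishes in `n` pairwise non-proportional
directions is zero. -/
lemma power_sum_eq_zero_of_roots {ι : Type*} [DecidableEq ι] (l : ι → ℝ × ℝ) (s : Finset ι) :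
    ∀ (n : ℕ) (lam : ι → ℝ) (Z : Finset (ℝ × ℝ)), s.card < n → n ≤ Z.card → (0 : ℝ × ℝ) ∉ Z →
      (∀ a ∈ Z, ∀ b ∈ Z, a ≠ b → a.1 * b.2 - a.2 * b.1 ≠ 0) →
      (∀ z ∈ Z, ∑ k ∈ s, lam k * ((l k).1 * z.1 + (l k).2 * z.2) ^ n = 0) →
      ∀ u : ℝ × ℝ, ∑ k ∈ s, lam k * ((l k).1 * u.1 + (l k).2 * u.2) ^ n = 0 := by
  classical
  induction s using Finset.induction_on with
  | empty => intros; simp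
  | insert j s hj ih =>
    intro n lam Z hn hZ hZ0 hZi hroot u
    rw [Finset.card_insert_of_notMem hj] at hn
    obtain ⟨m, rfl⟩ : ∃ m, n = m + 1 := ⟨n - 1, by omega⟩
    by_cases hlj : l j = 0
    · have hsum : ∀ u : ℝ × ℝ, ∑ k ∈ insert j s, lam k * ((l k).1 * u.1 + (l k).2 * u.2) ^ (m + 1)
          = ∑ k ∈ s, lam k * ((l k).1 * u.1 + (l k).2 * u.2) ^ (m + 1) := by
        intro u
        rw [Finset.sum_insert hj, hlj]
        simp
      simp only [hsum] at hroot ⊢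
      exact ih (m + 1) lam Z (by omega) hZ hZ0 hZi hroot u
    set H : ℝ × ℝ → ℝ :=
      fun u => ∑ k ∈ insert j s, lam k * ((l k).1 * u.1 + (l k).2 * u.2) ^ (m + 1) with hH
    have hHsmul : ∀ (α : ℝ) (u : ℝ × ℝ), H (α • u) = α ^ (m + 1) * H u := by
      intro α u
      simp only [hH, Finset.mul_sum]
      refine Finset.sum_congr rfl fun k _ => ?_
      simp only [Prod.smul_fst, Prod.smul_snd, smul_eq_mul]
      rw [show (l k).1 * (α * u.1) + (l k).2 * (α * u.2) =
        α * ((l k).1 * u.1 + (l k).2 * u.2) by ring, mul_pow]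
      ring
    set v : ℝ × ℝ := (-(l j).2, (l j).1) with hv
    set w : ℝ × ℝ := (-v.2, v.1) with hw
    have hN : 0 < v.1 ^ 2 + v.2 ^ 2 := by
      rcases (add_nonneg (sq_nonneg v.1) (sq_nonneg v.2)).lt_or_eq with h | h
      · exact h
      · exfalso; apply hlj
        have h1 : v.1 = 0 := by nlinarith [sq_nonneg v.1, sq_nonneg v.2]
        have h2 : v.2 = 0 := by nlinarith [sq_nonneg v.1, sq_nonneg v.2]
        simp only [hv] at h1 h2
        exact Prod.ext h2 (by simpa using h1)
    set N := v.1 ^ 2 + v.2 ^ 2 with hNdef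
    set a : ι → ℝ := fun k => (l k).1 * w.1 + (l k).2 * w.2 with ha
    set b : ι → ℝ := fun k => (l k).1 * v.1 + (l k).2 * v.2 with hb
    have hbj : b j = 0 := by simp only [hb, hv]; ring
    set P : Polynomial ℝ := ∑ k ∈ insert j s, Polynomial.C (lam k) *
      (Polynomial.C (a k) + Polynomial.C (b k) * Polynomial.X) ^ (m + 1) with hP
    have hPeval : ∀ t, P.eval t = H (w + t • v) := by
      intro t
      simp only [hP, hH, Polynomial.eval_finsetSum, Polynomial.eval_mul, Polynomial.eval_C,
        Polynomial.eval_pow, Polynomial.eval_add, Polynomial.eval_X]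
      refine Finset.sum_congr rfl fun k _ => ?_
      simp only [ha, hb, Prod.fst_add, Prod.snd_add, Prod.smul_fst, Prod.smul_snd, smul_eq_mul]
      ring
    have hP'eval : ∀ t, P.derivative.eval t = (m + 1) * ∑ k ∈ s, (lam k * b k) *
        ((l k).1 * (w + t • v).1 + (l k).2 * (w + t • v).2) ^ m := by
      intro t
      simp only [hP, Polynomial.derivative_sum, Polynomial.eval_finsetSum]
      rw [Finset.sum_insert hj, hbj, Finset.mul_sum]
      simp only [Polynomial.derivative_mul, Polynomial.derivative_C, Polynomial.derivative_pow]
      simp only [map_zero, zero_mul, add_zero, zero_add, Polynomial.derivative_C, mul_zero,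
        Polynomial.eval_zero]
      refine Finset.sum_congr rfl fun k _ => ?_
      simp [ha, hb]
      ring_nf
    have hdec : ∀ u : ℝ × ℝ, v.1 * u.2 - v.2 * u.1 ≠ 0 →
        u = ((v.1 * u.2 - v.2 * u.1) / N) •
          (w + ((v.1 * u.1 + v.2 * u.2) / (v.1 * u.2 - v.2 * u.1)) • v) := by
      intro u hu
      have hN0 := hN.ne'
      generalize hD : v.1 * u.2 - v.2 * u.1 = D at hu ⊢
      ext
      · simp only [hw, Prod.smul_fst, Prod.fst_add, smul_eq_mul]
        field_simp
        rw [← hD, hNdef]; ring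
      · simp only [hw, Prod.smul_snd, Prod.snd_add, smul_eq_mul]
        field_simp
        rw [← hD, hNdef]; ring
    have hpar : ∀ u : ℝ × ℝ, v.1 * u.2 - v.2 * u.1 = 0 →
        u = ((v.1 * u.1 + v.2 * u.2) / N) • v := by
      intro u hu
      have hN0 := hN.ne'
      ext
      · simp only [Prod.smul_fst, smul_eq_mul]
        field_simp
        rw [hNdef]; linear_combination -v.2 * hu
      · simp only [Prod.smul_snd, smul_eq_mul]
        field_simp
        rw [hNdef]; linear_combination v.1 * hu
    set Z₁ := Z.filter fun u => v.1 * u.2 - v.2 * u.1 ≠ 0 with hZ₁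
    set Z₀ := Z.filter fun u => ¬ (v.1 * u.2 - v.2 * u.1 ≠ 0) with hZ₀
    have hcard : Z₁.card + Z₀.card = Z.card := Finset.card_filter_add_card_filter_not _
    have hZ₀card : Z₀.card ≤ 1 := by
      rw [Finset.card_le_one]
      intro x hx y hy
      simp only [hZ₀, Finset.mem_filter, not_not] at hx hy
      by_contra hxy
      apply hZi x hx.1 y hy.1 hxy
      rw [hpar x hx.2, hpar y hy.2]
      simp only [Prod.smul_fst, Prod.smul_snd, smul_eq_mul]
      ring
    set τ : ℝ × ℝ → ℝ := fun u => (v.1 * u.1 + v.2 * u.2) / (v.1 * u.2 - v.2 * u.1) with hτ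
    have hτinj : Set.InjOn τ Z₁ := by
      intro x hx y hy hxy
      simp only [hZ₁, Finset.coe_filter, Set.mem_ofPred_eq] at hx hy
      by_contra hne
      apply hZi x hx.1 y hy.1 hne
      simp only [hτ] at hxy
      rw [hdec x hx.2, hdec y hy.2, hxy]
      simp only [Prod.smul_fst, Prod.smul_snd, smul_eq_mul, Prod.fst_add, Prod.snd_add]
      ring
    have hτroot : ∀ z ∈ Z₁, P.eval (τ z) = 0 := by
      intro z hz
      simp only [hZ₁, Finset.mem_filter] at hz
      have h := hroot z hz.1
      change H z = 0 at h
      rw [hdec z hz.2, hHsmul] at h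
      rw [hPeval]
      exact (mul_eq_zero.1 h).resolve_left (pow_ne_zero _ (div_ne_zero hz.2 hN.ne'))
    have hP' : P.derivative = 0 := by
      by_contra hP'
      have hP0 : P ≠ 0 := by rintro h; apply hP'; rw [h]; simp
      have hsub : Z₁.image τ ⊆ P.roots.toFinset := by
        intro t ht
        obtain ⟨z, hz, rfl⟩ := Finset.mem_image.1 ht
        simpa [hP0] using hτroot z hz
      have hle := Finset.card_le_card hsub
      rw [Finset.card_image_of_injOn hτinj] at hle
      have hrolle := Polynomial.card_roots_toFinset_le_derivative P
      set R := P.derivative.roots.toFinset with hR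
      set g : ℝ → ℝ × ℝ := fun t => w + t • v with hg
      have hcross : ∀ t, v.1 * (g t).2 - v.2 * (g t).1 = N := by
        intro t
        simp only [hg, hw, Prod.snd_add, Prod.smul_snd, Prod.fst_add, Prod.smul_fst, smul_eq_mul]
        rw [hNdef]; ring
      have hcross2 : ∀ t t', (g t).1 * (g t').2 - (g t).2 * (g t').1 = N * (t - t') := by
        intro t t'
        simp only [hg, hw, Prod.snd_add, Prod.smul_snd, Prod.fst_add, Prod.smul_fst, smul_eq_mul]
        rw [hNdef]; ring
      have hcross3 : ∀ (t γ : ℝ), (g t).1 * (γ • v).2 - (g t).2 * (γ • v).1 = -γ * N := by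
        intro t γ
        rw [← hcross t]
        simp only [Prod.smul_snd, Prod.smul_fst, smul_eq_mul]
        ring
      have hginj : Function.Injective g := by
        intro t t' h
        have h2 := hcross2 t t'
        rw [h] at h2
        have : N * (t - t') = 0 := by rw [← h2]; ring
        exact sub_eq_zero.1 ((mul_eq_zero.1 this).resolve_left hN.ne')
      have hdisj : Disjoint (R.image g) Z₀ := by
        rw [Finset.disjoint_left]
        intro x hx hx0
        obtain ⟨t, _, rfl⟩ := Finset.mem_image.1 hx
        simp only [hZ₀, Finset.mem_filter, not_not, hcross] at hx0
        exact hN.ne' hx0.2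
      have hpar0 : ∀ z ∈ Z₀, ∃ γ : ℝ, γ ≠ 0 ∧ z = γ • v := by
        intro z hz
        simp only [hZ₀, Finset.mem_filter, not_not] at hz
        refine ⟨_, ?_, hpar z hz.2⟩
        intro h
        have := hpar z hz.2
        rw [h, zero_smul] at this
        rw [this] at hz
        exact hZ0 hz.1
      have hfin := ih m (fun k => lam k * b k) (R.image g ∪ Z₀) (by omega) (by
          rw [Finset.card_union_of_disjoint hdisj, Finset.card_image_of_injective _ hginj]
          omega) (by
          rw [Finset.mem_union]
          rintro (h | h)
          · obtain ⟨t, _, ht⟩ := Finset.mem_image.1 h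
            have := hcross t
            rw [ht] at this
            simp at this
            exact hN.ne this
          · exact hZ0 (Finset.mem_filter.1 h).1) (by
          intro x hx y hy hxy
          rw [Finset.mem_union] at hx hy
          rcases hx with hx | hx <;> rcases hy with hy | hy
          · obtain ⟨t, _, rfl⟩ := Finset.mem_image.1 hx
            obtain ⟨t', _, rfl⟩ := Finset.mem_image.1 hy
            rw [hcross2]
            refine mul_ne_zero hN.ne' (sub_ne_zero.2 ?_)
            rintro rfl; exact hxy rfl
          · obtain ⟨t, _, rfl⟩ := Finset.mem_image.1 hx
            obtain ⟨γ, hγ, rfl⟩ := hpar0 y hy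
            rw [hcross3]
            exact mul_ne_zero (neg_ne_zero.2 hγ) hN.ne'
          · obtain ⟨t, _, rfl⟩ := Finset.mem_image.1 hy
            obtain ⟨γ, hγ, rfl⟩ := hpar0 x hx
            have := hcross3 t γ
            intro h
            refine mul_ne_zero (neg_ne_zero.2 hγ) hN.ne' ?_
            rw [← this]
            linear_combination -h
          · exact hZi x (Finset.mem_filter.1 hx).1 y (Finset.mem_filter.1 hy).1 hxy) (by
          intro z hz
          rw [Finset.mem_union] at hz
          rcases hz with hz | hz
          · obtain ⟨t, ht, rfl⟩ := Finset.mem_image.1 hz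
            have h1 : P.derivative.eval t = 0 := by simpa [hR, hP'] using ht
            rw [hP'eval] at h1
            exact (mul_eq_zero.1 h1).resolve_left (by positivity)
          · obtain ⟨γ, hγ, rfl⟩ := hpar0 z hz
            have h1 := hroot _ (Finset.mem_filter.1 hz).1
            change H (γ • v) = 0 at h1
            rw [hHsmul] at h1
            have h2 := (mul_eq_zero.1 h1).resolve_left (pow_ne_zero _ hγ)
            simp only [hH] at h2
            rw [Finset.sum_insert hj] at h2
            change lam j * b j ^ (m + 1) + ∑ k ∈ s, lam k * b k ^ (m + 1) = 0 at h2
            rw [hbj, zero_pow (by omega), mul_zero, zero_add] at h2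
            rw [← mul_zero (γ ^ m), ← h2, Finset.mul_sum]
            refine Finset.sum_congr rfl fun k _ => ?_
            simp only [Prod.smul_fst, Prod.smul_snd, smul_eq_mul]
            rw [show (l k).1 * (γ * v.1) + (l k).2 * (γ * v.2) = γ * b k by simp only [hb]; ring]
            ring_nf)
      apply hP'
      refine Polynomial.funext fun t => ?_
      rw [hP'eval, hfin]
      simp
    have hPC := Polynomial.eq_C_of_derivative_eq_zero hP'
    have hPzero : P = 0 := by
      obtain ⟨z, hz⟩ : Z₁.Nonempty := by
        rw [← Finset.card_pos]; omega
      have h := hτroot z hz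
      rw [hPC, Polynomial.eval_C] at h
      rw [hPC, h, map_zero]
    change H u = 0
    by_cases hu : v.1 * u.2 - v.2 * u.1 = 0
    · have hcoeff : H v = P.coeff (m + 1) := by
        simp only [hP, hH, Polynomial.finsetSum_coeff, Polynomial.coeff_C_mul]
        refine Finset.sum_congr rfl fun k _ => ?_
        have h1 : (Polynomial.C (a k) + Polynomial.C (b k) * Polynomial.X).natDegree ≤ 1 := by
          rw [add_comm]; exact Polynomial.natDegree_linear_le
        have := Polynomial.coeff_pow_of_natDegree_le (m := m + 1) h1
        rw [mul_one] at this
        rw [this]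
        simp [hb]
      rw [hpar u hu, hHsmul, hcoeff, hPzero]
      simp
    · rw [hdec u hu, hHsmul, ← hPeval, hPzero]
      simp

lemma exists_zero_of_mul_neg {φ : ℝ → ℝ} (hφ : Continuous φ) {a b : ℝ} (hab : a < b)
    (h : φ a * φ b < 0) : ∃ s ∈ Set.Ioo a b, φ s = 0 := by
  rcases mul_neg_iff.1 h with ⟨ha, hb⟩ | ⟨ha, hb⟩
  · obtain ⟨s, hs, h0⟩ := intermediate_value_Ioo' hab.le hφ.continuousOn ⟨hb, ha⟩
    exact ⟨s, hs, h0⟩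
  · obtain ⟨s, hs, h0⟩ := intermediate_value_Ioo hab.le hφ.continuousOn ⟨ha, hb⟩
    exact ⟨s, hs, h0⟩

/-- The point with parameter `t` on the affine line through the rotation of `e` by a right angle
with direction `e`. -/
def chartPoint (e : ℝ × ℝ) (t : ℝ) : Fin 2 → ℝ := ![t * e.1 - e.2, t * e.2 + e.1]

lemma not_isPowerSum_of_sign_changes {n r : ℕ} (hn : 1 ≤ n) (hr : r < n + 1)
    {f : MvPolynomial (Fin 2) ℝ} {e : ℝ × ℝ} (he : 0 < e.1 ^ 2 + e.2 ^ 2) {t : Fin (n + 1) → ℝ}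
    (ht : StrictMono t)
    (hs : ∀ i : Fin (n + 1), 0 < (-1 : ℝ) ^ (i : ℕ) * eval (chartPoint e (t i)) f) :
    ¬ IsPowerSum (n + 1) r f := by
  classical
  rintro ⟨lam, l, rfl⟩
  set F : ℝ × ℝ → ℝ :=
    fun u => ∑ k, lam k * ((l k).1 * u.1 + (l k).2 * u.2) ^ (n + 1) with hF
  set g : ℝ → ℝ × ℝ := fun s => (s * e.1 - e.2, s * e.2 + e.1) with hg
  have hFcont : Continuous F := by simp only [hF]; fun_prop
  have hgcont : Continuous g := by simp only [hg]; fun_prop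
  have hs' : ∀ i : Fin (n + 1), 0 < (-1 : ℝ) ^ (i : ℕ) * F (g (t i)) := by
    intro i
    simpa [chartPoint, hF, hg] using hs i
  have hFneg : ∀ u, F (-u) = (-1) ^ (n + 1) * F u := by
    intro u
    simp only [hF, Finset.mul_sum]
    refine Finset.sum_congr rfl fun k _ => ?_
    rw [show (l k).1 * (-u).1 + (l k).2 * (-u).2 = -1 * ((l k).1 * u.1 + (l k).2 * u.2) by
      simp only [Prod.fst_neg, Prod.snd_neg]; ring, mul_pow]
    ring
  have hzero : ∀ i : Fin n, ∃ s ∈ Set.Ioo (t i.castSucc) (t i.succ), F (g s) = 0 := by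
    intro i
    refine exists_zero_of_mul_neg (hFcont.comp hgcont) (ht i.castSucc_lt_succ) ?_
    have h1 := hs' i.castSucc
    have h2 := hs' i.succ
    simp only [Fin.val_castSucc, Fin.val_succ, pow_succ] at h1 h2
    simp only [Function.comp]
    rcases neg_one_pow_eq_or ℝ (i : ℕ) with h | h <;> rw [h] at h1 h2 <;> nlinarith
  choose s hsI hs0 using hzero
  have hsmono : StrictMono s := by
    intro i j hij
    calc s i < t i.succ := (hsI i).2
      _ ≤ t j.castSucc := ht.monotone (by
        rw [Fin.le_def]; simp only [Fin.val_succ, Fin.val_castSucc]; exact hij)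
      _ < s j := (hsI j).1
  have hlast : ∃ y ∈ Set.Ioo (0 : ℝ) 1, F ((1 - y) • g (t (Fin.last n)) + y • (-g (t 0))) = 0 := by
    refine exists_zero_of_mul_neg
      (φ := fun y => F ((1 - y) • g (t (Fin.last n)) + y • (-g (t 0)))) ?_ one_pos ?_
    · exact hFcont.comp (by fun_prop)
    · simp only [sub_zero, one_smul, zero_smul, add_zero, sub_self, zero_add, hFneg]
      have h1 := hs' 0
      have h2 := hs' (Fin.last n)
      simp only [Fin.val_zero, pow_zero, one_mul, Fin.val_last] at h1 h2
      rw [pow_succ]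
      rcases neg_one_pow_eq_or ℝ n with h | h <;> rw [h] at h2 ⊢ <;> nlinarith
  obtain ⟨y, ⟨hy0, hy1⟩, hyF⟩ := hlast
  set u : ℝ × ℝ := (1 - y) • g (t (Fin.last n)) + y • (-g (t 0)) with hu
  have hcross : ∀ x x', (g x).1 * (g x').2 - (g x).2 * (g x').1 =
      (x - x') * (e.1 ^ 2 + e.2 ^ 2) := by
    intro x x'; simp only [hg]; ring
  have hcrossu : ∀ x, (g x).1 * u.2 - (g x).2 * u.1 =
      ((1 - y) * (x - t (Fin.last n)) - y * (x - t 0)) * (e.1 ^ 2 + e.2 ^ 2) := by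
    intro x
    simp only [hu, hg, Prod.fst_add, Prod.snd_add, Prod.smul_fst, Prod.smul_snd, Prod.fst_neg,
      Prod.snd_neg, smul_eq_mul]
    ring
  have hneg : ∀ i, (g (s i)).1 * u.2 - (g (s i)).2 * u.1 ≠ 0 := by
    intro i
    rw [hcrossu]
    refine mul_ne_zero (ne_of_lt ?_) he.ne'
    have h1 : t 0 < s i := (ht.monotone (Fin.zero_le _)).trans_lt (hsI i).1
    have h2 : s i < t (Fin.last n) := (hsI i).2.trans_le (ht.monotone (Fin.le_last _))
    nlinarith
  have hginj : Function.Injective (fun i => g (s i)) := by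
    intro i j hij
    have h := hcross (s i) (s j)
    simp only at hij
    rw [hij] at h
    have h' : (s i - s j) * (e.1 ^ 2 + e.2 ^ 2) = 0 := by rw [← h]; ring
    exact hsmono.injective (sub_eq_zero.1 ((mul_eq_zero.1 h').resolve_right he.ne'))
  have hunot : u ∉ Finset.univ.image (fun i => g (s i)) := by
    intro h
    obtain ⟨i, _, hi⟩ := Finset.mem_image.1 h
    apply hneg i
    rw [hi]; ring
  have hall := power_sum_eq_zero_of_roots l Finset.univ (n + 1) lam
    (insert u (Finset.univ.image (fun i => g (s i)))) (by simpa using hr) (by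
      rw [Finset.card_insert_of_notMem hunot, Finset.card_image_of_injective _ hginj]
      simp) (by
      rw [Finset.mem_insert]
      rintro (h | h)
      · apply hneg ⟨0, hn⟩
        rw [← h]; simp
      · obtain ⟨i, _, hi⟩ := Finset.mem_image.1 h
        apply hneg i
        rw [hi]; simp) (by
      intro a ha b hb hab
      rw [Finset.mem_insert, Finset.mem_image] at ha hb
      rcases ha with rfl | ⟨i, _, rfl⟩ <;> rcases hb with rfl | ⟨j, _, rfl⟩
      · exact absurd rfl hab
      · intro h
        apply hneg j
        linear_combination -h
      · exact hneg i
      · rw [hcross]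
        refine mul_ne_zero (sub_ne_zero.2 ?_) he.ne'
        intro h
        rw [h] at hab
        exact hab rfl) (by
      intro z hz
      rw [Finset.mem_insert, Finset.mem_image] at hz
      rcases hz with rfl | ⟨i, _, rfl⟩
      · exact hyF
      · exact hs0 i)
  have h0 := hs' 0
  have : F (g (t 0)) = 0 := hall _
  rw [this] at h0
  simp at h0

lemma linear_forms_chart {l : ℝ × ℝ} {e : ℝ × ℝ} (h : l.1 * e.1 + l.2 * e.2 ≠ 0) (t : ℝ) :
    eval (chartPoint e t) (C l.1 * X 0 + C l.2 * X 1) =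
      (l.1 * e.1 + l.2 * e.2) * (t - (l.1 * e.2 - l.2 * e.1) / (l.1 * e.1 + l.2 * e.2)) := by
  rw [mul_sub, mul_div_cancel₀ _ h]
  simp [chartPoint]
  ring

lemma continuous_eval_toForm (d : ℕ) (v : Fin 2 → ℝ) :
    Continuous fun c : Fin (d + 1) → ℝ => eval v (toForm d c) := by
  simp only [eval_toForm]
  fun_prop

lemma typicalRank_self_of_strictMono {n : ℕ} (hn : 1 ≤ n) (l : Fin (n + 1) → ℝ × ℝ) (e : ℝ × ℝ)
    (hl : ∀ i, (l i).1 * e.1 + (l i).2 * e.2 ≠ 0)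
    (hmono : StrictMono fun i =>
      ((l i).1 * e.2 - (l i).2 * e.1) / ((l i).1 * e.1 + (l i).2 * e.2)) :
    TypicalRank (n + 1) (∏ i, (C (l i).1 * X 0 + C (l i).2 * X 1)) (n + 1 : ℕ) := by
  classical
  set t : Fin (n + 1) → ℝ :=
    fun i => ((l i).1 * e.2 - (l i).2 * e.1) / ((l i).1 * e.1 + (l i).2 * e.2) with ht
  set lin : Fin (n + 1) → MvPolynomial (Fin 2) ℝ :=
    fun i => C (l i).1 * X 0 + C (l i).2 * X 1 with hlin
  have hlin_eval : ∀ i s, eval (chartPoint e s) (lin i) =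
      ((l i).1 * e.1 + (l i).2 * e.2) * (s - t i) := fun i s => linear_forms_chart (hl i) s
  have hp0 : ∀ i, eval (chartPoint e (t i)) (∏ i, lin i) = 0 := by
    intro i
    rw [map_prod]
    exact Finset.prod_eq_zero (Finset.mem_univ i) (by rw [hlin_eval, sub_self, mul_zero])
  have he : 0 < e.1 ^ 2 + e.2 ^ 2 := by
    rcases (add_nonneg (sq_nonneg e.1) (sq_nonneg e.2)).lt_or_eq with h | h
    · exact h
    · exfalso
      have h1 : e.1 = 0 := by nlinarith [sq_nonneg e.1, sq_nonneg e.2]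
      have h2 : e.2 = 0 := by nlinarith [sq_nonneg e.1, sq_nonneg e.2]
      apply hl 0
      rw [h1, h2]; simp
  set U : Set (Fin (n + 1 + 1) → ℝ) := {c | ∀ i : Fin (n + 1),
    0 < (-1 : ℝ) ^ (i : ℕ) * eval (chartPoint e (t i)) (toForm (n + 1) c)} with hU
  have hUopen : IsOpen U := by
    simp only [hU, Set.ofPred_forall]
    exact isOpen_iInter_of_finite fun i =>
      isOpen_lt continuous_const (continuous_const.mul (continuous_eval_toForm _ _))
  have hUsub : U ⊆ {c | (¬ ∃ μ : ℝ, toForm (n + 1) c = μ • ∏ i, lin i) ∧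
      projRank (n + 1) (∏ i, lin i) (toForm (n + 1) c) = ((n + 1 : ℕ) : ℕ∞)} := by
    intro c hc
    refine ⟨?_, le_antisymm ?_ ?_⟩
    · rintro ⟨μ, hμ⟩
      have := hc 0
      rw [hμ, smul_eval, hp0] at this
      simp at this
    · refine projRank_le (μ := 0) ?_
      rw [zero_smul, add_zero]
      exact isPowerSum_toForm_self (by omega) c
    · by_contra hlt
      obtain ⟨r, hr, μ, h⟩ := projRank_lt_iff.1 (not_le.1 hlt)
      refine not_isPowerSum_of_sign_changes hn (by exact_mod_cast hr) he hmono ?_ h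
      intro i
      rw [map_add, smul_eval, hp0, mul_zero, add_zero]
      exact hc i
  set M : MvPolynomial (Fin 2) ℝ := C (-e.2) * X 0 + C e.1 * X 1 with hM
  set σ : Fin (n + 1) → ℝ := fun i =>
    (-1) ^ (i : ℕ) / ∏ j ∈ Finset.univ.erase i, eval (chartPoint e (t i)) (lin j) with hσ
  have hhom : (∑ i, C (σ i) * (M * ∏ j ∈ Finset.univ.erase i, lin j)).IsHomogeneous (n + 1) := by
    refine IsHomogeneous.sum _ _ _ fun i _ => ?_
    have h1 := IsHomogeneous.prod (Finset.univ.erase i) lin (fun _ => 1)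
      fun j _ => isHomogeneous_linear (l j).1 (l j).2
    have h2 := (isHomogeneous_linear (-e.2) e.1).mul h1
    have h3 := (isHomogeneous_C (Fin 2) (σ i)).mul h2
    convert h3 using 1
    simp
    omega
  obtain ⟨c, hc⟩ := exists_toForm hhom
  refine ⟨c, interior_maximal hUsub hUopen ?_⟩
  intro i
  rw [← hc, map_sum, Finset.sum_eq_single i]
  · have hne : ∏ j ∈ Finset.univ.erase i, eval (chartPoint e (t i)) (lin j) ≠ 0 := by
      refine Finset.prod_ne_zero_iff.2 fun j hj => ?_
      rw [hlin_eval]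
      refine mul_ne_zero (hl j) (sub_ne_zero.2 fun h => ?_)
      exact (Finset.mem_erase.1 hj).1 (hmono.injective h).symm
    have hMe : eval (chartPoint e (t i)) M = e.1 ^ 2 + e.2 ^ 2 := by
      simp [hM, chartPoint]; ring
    rw [map_mul, map_mul, map_prod, hMe, eval_C]
    simp only [hσ]
    have hsq : ((-1 : ℝ) ^ (i : ℕ)) * (-1) ^ (i : ℕ) = 1 := by
      rw [← mul_pow]; simp
    have : (-1 : ℝ) ^ (i : ℕ) * ((-1) ^ (i : ℕ) / (∏ j ∈ Finset.univ.erase i,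
        eval (chartPoint e (t i)) (lin j)) * ((e.1 ^ 2 + e.2 ^ 2) *
        ∏ j ∈ Finset.univ.erase i, eval (chartPoint e (t i)) (lin j))) = e.1 ^ 2 + e.2 ^ 2 := by
      field_simp
      rw [pow_two, hsq]
    rw [this]
    exact he
  · intro j _ hji
    rw [map_mul, map_mul, map_prod]
    rw [Finset.prod_eq_zero (Finset.mem_erase.2 ⟨hji.symm, Finset.mem_univ i⟩)
      (by rw [hlin_eval, sub_self, mul_zero])]
    simp
  · simp

lemma linear_form_ne_zero {a : ℝ × ℝ} (ha : a ≠ 0) :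
    (C a.1 * X 0 + C a.2 * X 1 : MvPolynomial (Fin 2) ℝ) ≠ 0 := by
  intro h
  apply ha
  have h1 := congrArg (eval ![1, 0]) h
  have h2 := congrArg (eval ![0, 1]) h
  simp at h1 h2
  exact Prod.ext h1 h2

lemma typicalRank_self {n : ℕ} (hn : 1 ≤ n) (l : Fin (n + 1) → ℝ × ℝ) (hl0 : ∀ i, l i ≠ 0)
    (hdist : ∀ i j, i ≠ j → ¬ ∃ t : ℝ, l i = t • l j) :
    TypicalRank (n + 1) (∏ i, (C (l i).1 * X 0 + C (l i).2 * X 1)) (n + 1 : ℕ) := by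
  have hp : (∏ i, (C (l i).1 * X 0 + C (l i).2 * X 1) : MvPolynomial (Fin 2) ℝ) ≠ 0 :=
    Finset.prod_ne_zero_iff.2 fun i _ => linear_form_ne_zero (hl0 i)
  obtain ⟨v, hv⟩ : ∃ v : Fin 2 → ℝ, eval v (∏ i, (C (l i).1 * X 0 + C (l i).2 * X 1)) ≠ 0 := by
    by_contra! h
    exact hp (MvPolynomial.funext (by simpa using h))
  rw [map_prod] at hv
  have hl : ∀ i, (l i).1 * v 0 + (l i).2 * v 1 ≠ 0 := by
    intro i
    simpa using Finset.prod_ne_zero_iff.1 hv i (Finset.mem_univ i)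
  set t : Fin (n + 1) → ℝ :=
    fun i => ((l i).1 * v 1 - (l i).2 * v 0) / ((l i).1 * v 0 + (l i).2 * v 1) with ht
  have htinj : Function.Injective t := by
    intro i j hij
    by_contra hne
    apply linear_form_cross (hl0 j) (hdist i j hne)
    simp only [ht] at hij
    rw [div_eq_div_iff (hl i) (hl j)] at hij
    have hv0 : v 0 ^ 2 + v 1 ^ 2 ≠ 0 := by
      intro h
      have h1 : v 0 = 0 := by nlinarith [sq_nonneg (v 0), sq_nonneg (v 1)]
      have h2 : v 1 = 0 := by nlinarith [sq_nonneg (v 0), sq_nonneg (v 1)]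
      apply hl 0
      rw [h1, h2]; simp
    have : ((l i).1 * (l j).2 - (l i).2 * (l j).1) * (v 0 ^ 2 + v 1 ^ 2) = 0 := by
      linear_combination hij
    exact (mul_eq_zero.1 this).resolve_right hv0
  have hmono : StrictMono (t ∘ Tuple.sort t) :=
    (Tuple.monotone_sort t).strictMono_of_injective (htinj.comp (Tuple.sort t).injective)
  have := typicalRank_self_of_strictMono hn (fun i => l (Tuple.sort t i)) (v 0, v 1)
    (fun i => hl _) hmono
  rwa [Equiv.prod_comp (Tuple.sort t) fun i => (C (l i).1 * X 0 + C (l i).2 * X 1)] at this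

lemma exists_aeval_eq_zero_of_card_lt {σ : Type} [Fintype σ] {N : ℕ} (h : Fintype.card σ < N)
    (F : Fin N → MvPolynomial σ ℝ) : ∃ G : MvPolynomial (Fin N) ℝ, G ≠ 0 ∧ aeval F G = 0 := by
  by_contra! hG
  have hind : AlgebraicIndependent ℝ F := by
    rw [algebraicIndependent_iff]
    intro G h0
    by_contra hne
    exact hG G hne h0
  have hle := hind.cardinalMk_le_trdeg
  rw [MvPolynomial.trdeg_of_isDomain] at hle
  simp only [Cardinal.mk_fintype, Fintype.card_fin, Cardinal.lift_natCast, Nat.cast_le] at hle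
  omega

lemma exists_eval_ne_zero_of_isOpen {N : ℕ} {G : MvPolynomial (Fin N) ℝ} (hG : G ≠ 0)
    {U : Set (Fin N → ℝ)} (hU : IsOpen U) (hne : U.Nonempty) : ∃ c ∈ U, eval c G ≠ 0 := by
  obtain ⟨c₀, hc₀⟩ := hne
  obtain ⟨δ, hδ, hball⟩ := Metric.isOpen_iff.1 hU c₀ hc₀
  by_contra! h
  apply hG
  refine MvPolynomial.funext_set (fun i => Metric.ball (c₀ i) δ) (fun i => ?_) fun x hx => ?_
  · rw [Real.ball_eq_Ioo]
    exact Set.Ioo_infinite (by linarith)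
  · rw [map_zero]
    apply h
    apply hball
    rw [ball_pi _ hδ]
    exact hx

lemma exists_sign_mul_pow {d : ℕ} (hd : d ≠ 0) (x : ℝ) :
    ∃ (b : Bool) (a : ℝ), x = (if b then 1 else -1) * a ^ d := by
  refine ⟨decide (0 ≤ x), |x| ^ (d : ℝ)⁻¹, ?_⟩
  rw [Real.rpow_inv_natCast_pow (abs_nonneg x) hd]
  by_cases hx : 0 ≤ x
  · simp [hx, abs_of_nonneg]
  · simp [hx, abs_of_neg (not_le.1 hx)]

/-- For `2 * r + 1 ≤ d`, the forms that are a sum of `r` powers modulo a fixed form lie on a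
hypersurface. -/
lemma exists_polynomial_vanishing_on_small_rank {d r : ℕ} (h : 2 * r + 1 ≤ d)
    (pc : Fin (d + 1) → ℝ) :
    ∃ G : MvPolynomial (Fin (d + 1)) ℝ, G ≠ 0 ∧ ∀ c : Fin (d + 1) → ℝ,
      (∃ μ : ℝ, IsPowerSum d r (toForm d c + μ • toForm d pc)) → eval c G = 0 := by
  classical
  let F : (Fin r → Bool) → Fin (d + 1) → MvPolynomial (Option (Fin r × Bool)) ℝ := fun ε k =>
    ∑ i, C ((if ε i then 1 else -1) * (d.choose k : ℝ)) * X (some (i, true)) ^ (k : ℕ) *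
      X (some (i, false)) ^ (d - (k : ℕ)) - X none * C (pc k)
  have hcard : Fintype.card (Option (Fin r × Bool)) < d + 1 := by
    simp; omega
  choose G hG0 hG using fun ε => exists_aeval_eq_zero_of_card_lt hcard (F ε)
  refine ⟨∏ ε, G ε, Finset.prod_ne_zero_iff.2 fun ε _ => hG0 ε, ?_⟩
  rintro c ⟨μ, lam, l, hl⟩
  choose ε a hεa using fun i => exists_sign_mul_pow (d := d) (by omega) (lam i)
  rw [map_prod]
  refine Finset.prod_eq_zero (Finset.mem_univ ε) ?_
  let x : Option (Fin r × Bool) → ℝ := fun o => o.elim μ fun q =>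
    if q.2 then a q.1 * (l q.1).1 else a q.1 * (l q.1).2
  have hc : c = fun k => eval x (F ε k) := by
    simp only [C_mul_linear_pow, ← toForm_sum, ← toForm_smul, ← toForm_add] at hl
    have hl' := toForm_injective d hl
    funext k
    have hk := congrFun hl' k
    simp only [Pi.add_apply, Pi.smul_apply, smul_eq_mul, Finset.sum_apply] at hk
    rw [eq_sub_of_add_eq hk]
    simp only [F, map_sub, map_sum, map_mul, map_pow, eval_C, eval_X, x, Option.elim]
    congr 1
    refine Finset.sum_congr rfl fun i _ => ?_
    have hkd : a i ^ d = a i ^ (k : ℕ) * a i ^ (d - (k : ℕ)) := by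
      rw [← pow_add]; congr 1; have := k.2; omega
    conv_lhs => rw [hεa i, hkd]
    simp only [if_true, Bool.false_eq_true, if_false, mul_pow]
    ring
  have := congrArg (eval x) (hG ε)
  rw [map_zero, MvPolynomial.map_aeval] at this
  have hC : (eval x).comp (algebraMap ℝ (MvPolynomial (Option (Fin r × Bool)) ℝ)) =
      RingHom.id ℝ := by
    ext
    simp
  rw [hC] at this
  rw [hc]
  exact this

lemma exists_double_nodes (N : Polynomial ℝ →ₗ[ℝ] ℝ) {m k : ℕ} (hk : k ≤ 2 * m)
    (hN : N (Polynomial.X ^ k) ≠ 0) :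
    ∃ t : Fin m → ℝ, Function.Injective t ∧
      N (∏ i, (Polynomial.X - Polynomial.C (t i)) ^ 2) ≠ 0 := by
  obtain ⟨R, hR, h⟩ := exists_polynomial_eval_pow N hk hN
  obtain ⟨s, hs⟩ : ∃ s, R.eval s ≠ 0 := by
    by_contra! h
    exact hR (Polynomial.funext (by simpa using h))
  rw [h] at hs
  let x : ℝ → Fin m → ℝ := fun ε i => s + ε * (i : ℕ)
  let b : Fin m → Polynomial (Polynomial ℝ) := fun i => Polynomial.C (Polynomial.X + Polynomial.C s)
    + Polynomial.X * Polynomial.C (Polynomial.C ((i : ℕ) : ℝ))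
  have hb : ∀ ε i, (b i).eval (Polynomial.C ε) = Polynomial.X + Polynomial.C (x ε i) := by
    intro ε i
    simp only [b, x, Polynomial.eval_add, Polynomial.eval_C, Polynomial.eval_mul,
      Polynomial.eval_X, map_add, map_mul]
    ring
  obtain ⟨S, hS⟩ := exists_polynomial_eval_eq N (∏ i, b i ^ 2)
  simp only [Polynomial.eval_prod, Polynomial.eval_pow, hb] at hS
  have hS0 : S ≠ 0 := by
    rintro rfl
    apply hs
    have h0 := hS 0
    simp only [x, zero_mul, add_zero, Finset.prod_const, Finset.card_univ, Fintype.card_fin,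
      ← pow_mul, Polynomial.eval_zero] at h0
    exact h0.symm
  obtain ⟨ε, hε⟩ : ∃ ε, (Polynomial.X * S).eval ε ≠ 0 := by
    by_contra! h
    exact mul_ne_zero Polynomial.X_ne_zero hS0 (Polynomial.funext (by simpa using h))
  rw [Polynomial.eval_mul, Polynomial.eval_X, hS] at hε
  refine ⟨fun i => -x ε i, fun i j hij => ?_, ?_⟩
  · have : ε * (i : ℕ) = ε * (j : ℕ) := by simpa [x] using hij
    exact Fin.ext (by exact_mod_cast mul_left_cancel₀ (left_ne_zero_of_mul hε) this)
  · simpa using right_ne_zero_of_mul hε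

lemma prod_sq_dvd {m : ℕ} {t : Fin m → ℝ} (ht : Function.Injective t) {P : Polynomial ℝ}
    (h0 : ∀ i, P.eval (t i) = 0) (h1 : ∀ i, P.derivative.eval (t i) = 0) :
    ∏ i, (Polynomial.X - Polynomial.C (t i)) ^ 2 ∣ P := by
  by_cases hP : P = 0
  · simp [hP]
  refine Finset.prod_dvd_of_coprime (fun i _ j _ hij => ?_) fun i _ => ?_
  · exact (Polynomial.isCoprime_X_sub_C_of_isUnit_sub
      (sub_ne_zero.2 (ht.ne hij)).isUnit).pow
  · exact (Polynomial.le_rootMultiplicity_iff hP).1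
      ((Polynomial.one_lt_rootMultiplicity_iff_isRoot hP).2 ⟨h0 i, h1 i⟩)

lemma exists_nhds_isPowerSum {d m : ℕ} (hdm : d ≤ 2 * m) {pc : Fin (d + 1) → ℝ} (hpc : pc ≠ 0) :
    ∃ c₀ : Fin (d + 1) → ℝ,
      {c | ∃ μ : ℝ, IsPowerSum d m (toForm d c + μ • toForm d pc)} ∈ nhds c₀ := by
  classical
  obtain ⟨k₀, hk₀⟩ := Function.ne_iff.1 hpc
  have hN₀ : apolarFunctional d pc (Polynomial.X ^ (k₀ : ℕ)) ≠ 0 := by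
    rw [apolarFunctional_X_pow]
    exact div_ne_zero hk₀ (choose_ne_zero_real k₀)
  obtain ⟨t, htinj, htN⟩ := exists_double_nodes _ ((Nat.lt_succ_iff.1 k₀.2).trans hdm) hN₀
  let Φ : (Fin m → ℝ) × (Fin m → ℝ) × ℝ → Fin (d + 1) → ℝ := fun x k =>
    ∑ i, x.1 i * d.choose k * x.2.1 i ^ (k : ℕ) - x.2.2 * pc k
  have hΦ : ContDiff ℝ 1 Φ := by
    rw [contDiff_pi]
    intro k
    fun_prop
  let x₀ : (Fin m → ℝ) × (Fin m → ℝ) × ℝ := (1, t, 0)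
  have hstrict := hΦ.contDiffAt.hasStrictFDerivAt (x := x₀) one_ne_zero
  set Φ' := fderiv ℝ Φ x₀ with hΦ'
  have hval : ∀ v k, Φ' v k = ∑ i, d.choose k * (v.1 i * t i ^ (k : ℕ) +
      ((k : ℕ) * t i ^ ((k : ℕ) - 1)) * v.2.1 i) - v.2.2 * pc k := by
    intro v k
    have hline : HasDerivAt (fun s : ℝ => x₀ + s • v) v 0 := by
      simpa using ((hasDerivAt_id (0 : ℝ)).smul_const v).const_add x₀
    have hf : HasFDerivAt Φ Φ' (x₀ + (0 : ℝ) • v) := by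
      rw [zero_smul, add_zero]; exact hstrict.hasFDerivAt
    have h1 := hasDerivAt_pi.1 (hf.comp_hasDerivAt (0 : ℝ) hline) k
    refine h1.unique ?_
    have h2 : HasDerivAt (fun s : ℝ => ∑ i, (1 + s * v.1 i) * d.choose k *
        (t i + s * v.2.1 i) ^ (k : ℕ) - s * v.2.2 * pc k) (∑ i, d.choose k * (v.1 i * t i ^ (k : ℕ) +
      ((k : ℕ) * t i ^ ((k : ℕ) - 1)) * v.2.1 i) - v.2.2 * pc k) 0 := by
      refine HasDerivAt.sub (HasDerivAt.fun_sum fun i _ => ?_) ?_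
      · have ha := (((hasDerivAt_id (0 : ℝ)).mul_const (v.1 i)).const_add 1).mul_const
          (d.choose k : ℝ)
        have hb := (((hasDerivAt_id (0 : ℝ)).mul_const (v.2.1 i)).const_add (t i)).pow (k : ℕ)
        refine (ha.mul hb).congr_deriv ?_
        simp only [id, zero_mul, add_zero, one_mul, Pi.pow_apply]
        ring
      · simpa using ((hasDerivAt_id (0 : ℝ)).mul_const v.2.2).mul_const (pc k)
    have heq : (fun s : ℝ => (Φ ∘ fun s : ℝ => x₀ + s • v) s k) = fun s : ℝ =>
        ∑ i, (1 + s * v.1 i) * d.choose k * (t i + s * v.2.1 i) ^ (k : ℕ) - s * v.2.2 * pc k := by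
      funext s
      simp [Φ, x₀]
    rw [← heq] at h2
    exact h2
  have hrange : (Φ' : (Fin m → ℝ) × (Fin m → ℝ) × ℝ →ₗ[ℝ] Fin (d + 1) → ℝ).range = ⊤ := by
    by_contra hne
    obtain ⟨f, hf0, hf⟩ := Submodule.exists_le_ker_of_lt_top _ (lt_top_iff_ne_top.2 hne)
    have hfΦ : ∀ v, ∑ k, Φ' v k * f (Pi.single k 1) = 0 := by
      intro v
      have h : f (Φ' v) = 0 := hf ⟨v, rfl⟩
      rw [LinearMap.pi_apply_eq_sum_univ f] at h
      have hsingle : ∀ k : Fin (d + 1),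
          (fun j => if k = j then (1 : ℝ) else 0) = Pi.single k 1 := by
        intro k
        funext j
        simp [Pi.single_apply, eq_comm]
      simpa only [hsingle, smul_eq_mul] using h
    set φ : Fin (d + 1) → ℝ := fun k => f (Pi.single k 1) with hφ
    set P : Polynomial ℝ :=
      ∑ k : Fin (d + 1), Polynomial.C (φ k * d.choose k) * Polynomial.X ^ (k : ℕ) with hP
    have hPcoeff : ∀ k : Fin (d + 1), P.coeff k = φ k * d.choose k := by
      intro k
      simp only [hP, Polynomial.finsetSum_coeff, Polynomial.coeff_C_mul, Polynomial.coeff_X_pow,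
        Fin.val_inj]
      simp
    have hP0 : P ≠ 0 := by
      intro h
      apply hf0
      refine LinearMap.pi_ext' fun k => LinearMap.ext_ring ?_
      have := hPcoeff k
      rw [h, Polynomial.coeff_zero] at this
      exact (mul_eq_zero.1 this.symm).resolve_right (choose_ne_zero_real k)
    have hPdeg : P.natDegree ≤ d :=
      Polynomial.natDegree_sum_le_of_forall_le _ _ fun k _ =>
        (Polynomial.natDegree_C_mul_X_pow_le _ _).trans (Nat.lt_succ_iff.1 k.2)
    have hroot : ∀ i, P.eval (t i) = 0 := by
      intro i
      rw [← hfΦ (Pi.single i 1, 0, 0)]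
      simp only [hval, hP, Polynomial.eval_finsetSum]
      refine Finset.sum_congr rfl fun k _ => ?_
      simp [Pi.single_apply, hφ]
      ring
    have hroot' : ∀ i, P.derivative.eval (t i) = 0 := by
      intro i
      rw [← hfΦ (0, Pi.single i 1, 0)]
      simp only [hval, hP, Polynomial.derivative_sum, Polynomial.eval_finsetSum]
      refine Finset.sum_congr rfl fun k _ => ?_
      simp [Pi.single_apply, hφ, Polynomial.derivative_X_pow]
      ring
    have hNP : apolarFunctional d pc P = 0 := by
      rw [← neg_eq_zero, ← hfΦ (0, 0, 1)]
      simp only [hval, hP, map_sum]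
      rw [← Finset.sum_neg_distrib]
      refine Finset.sum_congr rfl fun k _ => ?_
      rw [← Polynomial.smul_eq_C_mul, map_smul, apolarFunctional_X_pow]
      have := choose_ne_zero_real k
      simp [hφ]
      field_simp
    obtain ⟨Q, hQ⟩ := prod_sq_dvd htinj hroot hroot'
    have hQ0 : Q ≠ 0 := by rintro rfl; simp [hP0] at hQ
    have hmonic : (∏ i, (Polynomial.X - Polynomial.C (t i)) ^ 2).Monic :=
      Polynomial.monic_prod_of_monic _ _ fun i _ => (Polynomial.monic_X_sub_C _).pow 2
    have hdegProd : (∏ i, (Polynomial.X - Polynomial.C (t i)) ^ 2).natDegree = 2 * m := by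
      rw [Polynomial.natDegree_prod_of_monic _ _ fun i _ => (Polynomial.monic_X_sub_C _).pow 2]
      simp [mul_comm]
    have hdegQ : Q.natDegree = 0 := by
      have := hmonic.natDegree_mul' hQ0
      rw [← hQ, hdegProd] at this
      omega
    rw [Polynomial.eq_C_of_natDegree_eq_zero hdegQ] at hQ hQ0
    rw [mul_comm, ← Polynomial.smul_eq_C_mul] at hQ
    rw [hQ, map_smul] at hNP
    rcases smul_eq_zero.1 hNP with h | h
    · rw [h, map_zero] at hQ0; exact hQ0 rfl
    · exact htN h
  refine ⟨Φ x₀, ?_⟩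
  rw [← hstrict.map_nhds_eq_of_surj hrange, Filter.mem_map]
  refine Filter.univ_mem' fun x => ?_
  refine ⟨x.2.2, ?_⟩
  rw [← toForm_smul, ← toForm_add]
  refine toForm_isPowerSum x.1 x.2.1 fun k => ?_
  simp [Φ]

/-- For the projection of the rational normal curve of degree `d ≥ 3` from a hyperbolic form
`p` with distinct roots: (i) every form `q ∉ ℝ·p` has rank at most `d`; (ii) the minimal
typical rank is `⌈d/2⌉`; (iii) `d` is a typical rank. -/
theorem statement13 (d : ℕ) (hd : 3 ≤ d) (l : Fin d → ℝ × ℝ)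
    (hdist : ∀ i j, i ≠ j → ¬ ∃ t : ℝ, l i = t • l j)
    (p : MvPolynomial (Fin 2) ℝ)
    (hp : p = ∏ i, (C (l i).1 * X 0 + C (l i).2 * X 1)) :
    (∀ q : MvPolynomial (Fin 2) ℝ, q.IsHomogeneous d → (¬ ∃ μ : ℝ, q = μ • p) →
      projRank d p q ≤ (d : ℕ∞)) ∧
    (TypicalRank d p ((d + 1) / 2 : ℕ) ∧
      ∀ r : ℕ, r < (d + 1) / 2 → ¬ TypicalRank d p r) ∧
    TypicalRank d p (d : ℕ) := by
  subst hp
  have hl0 : ∀ i, l i ≠ 0 := by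
    intro i hi
    obtain ⟨j, hj⟩ : ∃ j : Fin d, i ≠ j := by
      have : Nontrivial (Fin d) := Fin.nontrivial_iff_two_le.2 (by omega)
      obtain ⟨j, hj⟩ := exists_ne i
      exact ⟨j, hj.symm⟩
    exact hdist i j hj ⟨0, by simp [hi]⟩
  have hhom : (∏ i, (C (l i).1 * X 0 + C (l i).2 * X 1) : MvPolynomial (Fin 2) ℝ).IsHomogeneous
      d := by
    have := IsHomogeneous.prod Finset.univ
      (fun i => (C (l i).1 * X 0 + C (l i).2 * X 1 : MvPolynomial (Fin 2) ℝ)) (fun _ => 1)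
      fun i _ => isHomogeneous_linear (l i).1 (l i).2
    simpa using this
  obtain ⟨pc, hpc⟩ := exists_toForm hhom
  have hpc0 : pc ≠ 0 := by
    rintro rfl
    refine Finset.prod_ne_zero_iff.2 (fun i (_ : i ∈ Finset.univ) =>
      linear_form_ne_zero (hl0 i)) (hpc.trans ?_)
    simp [toForm]
  refine ⟨fun q hq _ => ?_, ?_, ?_⟩
  · obtain ⟨c, rfl⟩ := exists_toForm hq
    refine projRank_le (μ := 0) ?_
    rw [zero_smul, add_zero]
    exact isPowerSum_toForm_self (by omega) c
  · rw [hpc]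
    set m := (d + 1) / 2 with hm
    obtain ⟨G, hG0, hG⟩ := exists_polynomial_vanishing_on_small_rank (d := d) (r := m - 1)
      (by omega) pc
    have hsmall : ∀ c, projRank d (toForm d pc) (toForm d c) < (m : ℕ∞) → eval c G = 0 := by
      intro c hc
      obtain ⟨r, hr, μ, h⟩ := projRank_lt_iff.1 hc
      have hr' : r < m := by exact_mod_cast hr
      exact hG c ⟨μ, h.mono (by omega)⟩
    constructor
    · obtain ⟨c₀, hc₀⟩ := exists_nhds_isPowerSum (d := d) (m := m) (by omega) hpc0
      obtain ⟨U, hUsub, hUopen, hcU⟩ := mem_nhds_iff.1 hc₀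
      obtain ⟨c, hcU, hcG⟩ := exists_eval_ne_zero_of_isOpen hG0 hUopen ⟨c₀, hcU⟩
      have hVopen : IsOpen (U ∩ {c | eval c G ≠ 0}) :=
        hUopen.inter ((isClosed_singleton.preimage G.continuous_eval).isOpen_compl)
      refine ⟨c, interior_maximal ?_ hVopen ⟨hcU, hcG⟩⟩
      rintro c' ⟨hc'U, hc'G⟩
      refine ⟨?_, le_antisymm ?_ ?_⟩
      · rintro ⟨μ, hμ⟩
        refine hc'G (hG c' ⟨-μ, IsPowerSum.mono (r := 0) ⟨0, 0, ?_⟩ (Nat.zero_le _)⟩)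
        rw [hμ]
        simp
      · obtain ⟨μ, h⟩ := hUsub hc'U
        exact projRank_le h
      · by_contra hlt
        exact hc'G (hsmall c' (not_le.1 hlt))
    · rintro r hr hne
      obtain ⟨c, hc, hcG⟩ := exists_eval_ne_zero_of_isOpen hG0 isOpen_interior hne
      refine hcG (hsmall c ?_)
      rw [(interior_subset hc).2]
      exact_mod_cast hr
  · obtain ⟨n, rfl⟩ : ∃ n, d = n + 1 := ⟨d - 1, by omega⟩
    exact typicalRank_self (by omega) l hl0 hdist
end

section
/- Let F ∈ ℝ[x₀,x₁,x₂] be a homogeneous polynomial of degree at least 2 that is irreducible over ℂ, let C = { x ∈ ℝ³ : F(x) = 0 }, and assume C ∖ {0} is nonempty and ∇F(x) ≠ 0 for every x ∈ C ∖ {0}. Call a 2-dimensional linear subspace W ⊆ ℝ³ an odd tangent if there exist linearly independent vectors a, b ∈ W with a ∈ C such that the order of vanishing at t = 0 of the univariate polynomial t ↦ F(a + t·b) is an odd number at least 3. Let H ⊆ ℝ³ be the union of all odd tangents. Then the set { p ∈ ℝ³ ∖ (H ∪ {0}) : rank_C(p) = 3 } is both open and closed in ℝ³ ∖ (H ∪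 {0}) with the Euclidean topology; in other words, it is a union of connected components of ℝ³ ∖ (H ∪ {0}). -/
open scoped BigOperators
open MvPolynomial

/-- The real rank of `p` with respect to a subset `S` of a real vector space:
the least `r : ℕ∞` such that `p` is a sum of `r` elements of `S` (`∞` if none exists). -/
noncomputable def realRank {V : Type*} [AddCommMonoid V] (S : Set V) (p : V) : ℕ∞ :=
  sInf ((fun n : ℕ => (n : ℕ∞)) ''
    {r : ℕ | ∃ x : Fin r → V, (∀ i, x i ∈ S) ∧ ∑ i, x i = p})

open Filter Topology

section General

variable {σ : Type*}

/-- The differential at `x` of the function defined by a real polynomial. -/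
noncomputable def polyDifferential [Fintype σ]
    (F : MvPolynomial σ ℝ) (x : σ → ℝ) : (σ → ℝ) →L[ℝ] ℝ :=
  ∑ i, eval x (pderiv i F) • (ContinuousLinearMap.proj i : (σ → ℝ) →L[ℝ] ℝ)

lemma polyDifferential_apply [Fintype σ] (F : MvPolynomial σ ℝ) (x v : σ → ℝ) :
    polyDifferential F x v = ∑ i, eval x (pderiv i F) * v i := by
  simp [polyDifferential]

lemma polyDifferential_ne_zero [Fintype σ] {F : MvPolynomial σ ℝ} {x : σ → ℝ} {i : σ}
    (h : eval x (pderiv i F) ≠ 0) : polyDifferential F x ≠ 0 := by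
  classical
  intro h0
  apply h
  have := congrArg (fun L => L (Pi.single i 1)) h0
  simpa [polyDifferential_apply, Pi.single_apply] using this

lemma hasFDerivAt_eval [Fintype σ] (F : MvPolynomial σ ℝ) (x : σ → ℝ) :
    HasFDerivAt (fun y => eval y F) (polyDifferential F x) x := by
  classical
  induction F using MvPolynomial.induction_on with
  | C a => simpa [polyDifferential] using hasFDerivAt_const a x
  | add p q hp hq =>
    simp only [map_add]
    refine (hp.add hq).congr_fderiv ?_
    ext v
    simp [polyDifferential_apply, add_mul, Finset.sum_add_distrib]
  | mul_X p j hp =>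
    simp only [map_mul, eval_X]
    refine (hp.mul (hasFDerivAt_apply j x)).congr_fderiv ?_
    ext v
    simp [polyDifferential_apply, pderiv_X, Pi.single_apply, Finset.sum_add_distrib, add_mul,
      Finset.mul_sum, apply_ite]
    exact Finset.sum_congr rfl fun i _ => by ring

lemma hasDerivAt_eval_line [Fintype σ] (F : MvPolynomial σ ℝ) (x v : σ → ℝ) (t : ℝ) :
    HasDerivAt (fun s : ℝ => eval (x + s • v) F) (polyDifferential F (x + t • v) v) t := by
  have h : HasDerivAt (fun s : ℝ => x + s • v) v t := by
    simpa using ((hasDerivAt_id t).smul_const v).const_add x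
  exact (hasFDerivAt_eval F (x + t • v)).comp_hasDerivAt t h

lemma continuous_polyDifferential_apply [Fintype σ] (F : MvPolynomial σ ℝ) :
    Continuous fun q : (σ → ℝ) × (σ → ℝ) => polyDifferential F q.1 q.2 := by
  simp only [polyDifferential_apply]
  refine continuous_finsetSum _ fun i _ => ?_
  exact ((continuous_eval _).comp continuous_fst).mul ((continuous_apply i).comp continuous_snd)

lemma MvPolynomial.IsHomogeneous.eval_smul_real [Fintype σ] {F : MvPolynomial σ ℝ} {m : ℕ}
    (hF : F.IsHomogeneous m) (c : ℝ) (x : σ → ℝ) : eval (c • x) F = c ^ m * eval x F := by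
  rw [eval_eq', eval_eq', Finset.mul_sum]
  refine Finset.sum_congr rfl fun d hd => ?_
  have : ∑ i, d i = m := by
    rw [hF.degree_eq_sum_deg_support hd]
    exact (Finset.sum_subset (Finset.subset_univ _) (by simp)).symm
  simp only [Pi.smul_apply, smul_eq_mul, mul_pow, Finset.prod_mul_distrib,
    Finset.prod_pow_eq_pow_sum, this]
  ring

/-- The restriction of a polynomial to the affine line through `a` with direction `b`. -/
noncomputable def lineRestriction (F : MvPolynomial σ ℝ) (a b : σ → ℝ) : Polynomial ℝ :=
  MvPolynomial.aeval (fun i => Polynomial.C (a i) + Polynomial.C (b i) * Polynomial.X) F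

lemma eval_lineRestriction (F : MvPolynomial σ ℝ) (a b : σ → ℝ) (t : ℝ) :
    (lineRestriction F a b).eval t = eval (a + t • b) F := by
  rw [lineRestriction, ← Polynomial.coe_evalRingHom, MvPolynomial.map_aeval]
  change eval₂ _ _ F = eval₂ _ _ F
  congr 1
  · exact Subsingleton.elim _ _
  · ext i
    change Polynomial.eval t _ = _
    simp only [Polynomial.eval_add, Polynomial.eval_C, Polynomial.eval_mul, Polynomial.eval_X,
      Pi.add_apply, Pi.smul_apply, smul_eq_mul]
    ring

/-- A polynomial vanishing on the kernel of a nonzero linear form is divisible by a linear form. -/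
lemma exists_linear_dvd_of_vanishing [Fintype σ]
    (F : MvPolynomial σ ℝ) (l : (σ → ℝ) →ₗ[ℝ] ℝ) (hl : l ≠ 0)
    (h : ∀ x, l x = 0 → eval x F = 0) :
    ∃ L : MvPolynomial σ ℝ, L.IsHomogeneous 1 ∧ L ∣ F := by
  classical
  obtain ⟨e, he⟩ : ∃ e, l e ≠ 0 := by
    by_contra! h0
    exact hl (LinearMap.ext h0)
  set L : MvPolynomial σ ℝ := ∑ i, C (l (Pi.single i 1)) * X i with hL
  have hLe : ∀ x, eval x L = l x := by
    intro x
    rw [LinearMap.pi_apply_eq_sum_univ l x]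
    simp only [hL, map_sum, map_mul, eval_C, eval_X, smul_eq_mul]
    refine Finset.sum_congr rfl fun i _ => ?_
    rw [mul_comm]
    congr 2
    ext j
    rw [Pi.single_apply]
    exact if_congr eq_comm rfl rfl
  refine ⟨L, IsHomogeneous.sum _ _ _ fun i _ => isHomogeneous_C_mul_X _ _, ?_⟩
  let π : σ → MvPolynomial σ ℝ := fun i => X i - C (e i / l e) * L
  have hπ : aeval π F = 0 := by
    apply MvPolynomial.funext
    intro x
    rw [map_zero]
    have hx := h (x - (l x / l e) • e) (by simp [he])
    rw [← hx, MvPolynomial.map_aeval]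
    change eval₂ _ _ F = eval₂ _ _ F
    congr 1
    · ext; simp
    · ext i; simp [π, hLe]; ring
  rw [← Ideal.mem_span_singleton, ← Ideal.Quotient.eq_zero_iff_mem]
  have key : (Ideal.Quotient.mkₐ ℝ (Ideal.span {L})).comp (aeval π)
      = Ideal.Quotient.mkₐ ℝ (Ideal.span {L}) := by
    apply MvPolynomial.algHom_ext
    intro i
    have : Ideal.Quotient.mk (Ideal.span {L}) L = 0 :=
      Ideal.Quotient.eq_zero_iff_mem.2 (Ideal.mem_span_singleton_self L)
    simp [π, this]
  have := congrArg (fun φ => φ F) key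
  simpa only [AlgHom.comp_apply, hπ, map_zero, Ideal.Quotient.mkₐ_eq_mk] using this.symm

lemma not_dvd_linear_of_irreducible_map {F : MvPolynomial σ ℝ} {m : ℕ} (hm : 2 ≤ m)
    (hF : F.IsHomogeneous m) (hirr : Irreducible (MvPolynomial.map (algebraMap ℝ ℂ) F))
    {L : MvPolynomial σ ℝ} (hL : L.IsHomogeneous 1) : ¬ L ∣ F := by
  rintro ⟨G, rfl⟩
  have hdeg := (hF.map (algebraMap ℝ ℂ)).totalDegree hirr.ne_zero
  have hne := hirr.ne_zero
  rw [map_mul] at hirr hdeg hne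
  have hL' := hL.map (algebraMap ℝ ℂ)
  have hLd := hL'.totalDegree (left_ne_zero_of_mul hne)
  rw [totalDegree_mul_of_isDomain (left_ne_zero_of_mul hne) (right_ne_zero_of_mul hne)] at hdeg
  rcases hirr.isUnit_or_isUnit rfl with h | h
  · have := (isUnit_iff_totalDegree_of_isReduced.1 h).2
    omega
  · have := (isUnit_iff_totalDegree_of_isReduced.1 h).2
    omega

lemma eventually_exists_eval_add_smul_eq_zero [Fintype σ] {F : MvPolynomial σ ℝ} {x v : σ → ℝ}
    (hx : eval x F = 0) (hv : polyDifferential F x v ≠ 0) {ε : ℝ} (hε : 0 < ε) :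
    ∀ᶠ y in 𝓝 x, ∃ t : ℝ, |t| < ε ∧ eval (y + t • v) F = 0 := by
  have hder : HasDerivAt (fun s : ℝ => eval (x + s • v) F) (polyDifferential F x v) 0 := by
    simpa using hasDerivAt_eval_line F x v 0
  have hball : ∀ᶠ t : ℝ in 𝓝 0, |t| < ε := by
    filter_upwards [Metric.ball_mem_nhds (0 : ℝ) hε] with t ht
    simpa using ht
  have hcont : ∀ t : ℝ, Continuous fun y : σ → ℝ => eval (y + t • v) F := fun t =>
    (continuous_eval F).comp (continuous_id.add continuous_const)
  obtain ⟨t₁, ht₁, hneg⟩ : ∃ t : ℝ, |t| < ε ∧ eval (x + t • v) F < 0 := by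
    by_contra! h
    refine hv (IsLocalMin.hasDerivAt_eq_zero ?_ hder)
    filter_upwards [hball] with t ht
    simpa [hx] using h t ht
  obtain ⟨t₂, ht₂, hpos⟩ : ∃ t : ℝ, |t| < ε ∧ 0 < eval (x + t • v) F := by
    by_contra! h
    refine hv (IsLocalMax.hasDerivAt_eq_zero ?_ hder)
    filter_upwards [hball] with t ht
    simpa [hx] using h t ht
  filter_upwards [(hcont t₁).continuousAt.eventually_lt_const hneg,
    (hcont t₂).continuousAt.eventually_const_lt hpos] with y hy₁ hy₂
  have hline : Continuous fun t : ℝ => eval (y + t • v) F :=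
    (continuous_eval F).comp (by fun_prop)
  obtain ⟨t, ht, h0⟩ := intermediate_value_uIcc (a := t₁) (b := t₂) hline.continuousOn
    (Set.mem_uIcc_of_le hy₁.le hy₂.le)
  refine ⟨t, ?_, h0⟩
  rw [abs_lt] at *
  rcases Set.mem_uIcc.1 ht with h | h <;> constructor <;> linarith [h.1, h.2]

/-- Sums of two zeros of `f`. -/
def zeroSums (f : (σ → ℝ) → ℝ) : Set (σ → ℝ) :=
  {p | ∃ x y, f x = 0 ∧ f y = 0 ∧ x + y = p}

lemma zeroSums_mem_nhds_of_ne_zero [Fintype σ]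
    {F : MvPolynomial σ ℝ} {m : ℕ} (hF : F.IsHomogeneous m)
    {x y : σ → ℝ} (hx : eval x F = 0) (hy : eval y F = 0)
    (hxy : polyDifferential F x y ≠ 0) (s : ℝ) :
    zeroSums (fun z => eval z F) ∈ 𝓝 (x + s • y) := by
  have ht : Tendsto (fun q => q - s • y) (𝓝 (x + s • y)) (𝓝 x) := by
    have : Continuous fun q : σ → ℝ => q - s • y := by fun_prop
    simpa using this.tendsto (x + s • y)
  filter_upwards [ht.eventually (eventually_exists_eval_add_smul_eq_zero hx hxy one_pos)]
    with q ⟨t, _, h⟩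
  refine ⟨_, (s - t) • y, h, by simp [hF.eval_smul_real, hy], ?_⟩
  module

lemma zeroSums_mem_nhds_of_same_sign {f : (σ → ℝ) → ℝ} (hf : Continuous f)
    (hcone : ∀ (c : ℝ) x, f x = 0 → f (c • x) = 0) {x p : σ → ℝ} {δ : ℝ} (hδ : 0 < δ)
    (h₁ : 0 < f (x + δ • p)) (h₂ : 0 < f (x + (-δ) • p)) (hx : ∃ᶠ y in 𝓝 x, f y < 0) :
    zeroSums f ∈ 𝓝 p := by
  have hc : ∀ t : ℝ, Continuous fun y : σ → ℝ => f (y + t • p) := fun t =>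
    hf.comp (by fun_prop)
  have hc' : ∀ (t : ℝ) (y : σ → ℝ), Continuous fun q : σ → ℝ => f (y + t • q) := fun t y =>
    hf.comp (by fun_prop)
  obtain ⟨y, hy, hy₁, hy₂⟩ := (hx.and_eventually
    (((hc δ).continuousAt.eventually_const_lt h₁).and
      ((hc (-δ)).continuousAt.eventually_const_lt h₂))).exists
  filter_upwards [(hc' δ y).continuousAt.eventually_const_lt hy₁,
    (hc' (-δ) y).continuousAt.eventually_const_lt hy₂] with q hq₁ hq₂
  have hline : Continuous fun t : ℝ => f (y + t • q) := hf.comp (by fun_prop)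
  have hy0 : f (y + (0 : ℝ) • q) < 0 := by simpa using hy
  obtain ⟨t, ht, h0⟩ := intermediate_value_Ioo hδ.le hline.continuousOn ⟨hy0, hq₁⟩
  obtain ⟨s, hs, hs0⟩ := intermediate_value_Ioo' (neg_lt_zero.2 hδ).le hline.continuousOn
    ⟨hy0, hq₂⟩
  have hts : t - s ≠ 0 := (sub_pos.2 (hs.2.trans ht.1)).ne'
  refine ⟨(t - s)⁻¹ • (y + t • q), (-(t - s)⁻¹) • (y + s • q), hcone _ _ h0, hcone _ _ hs0, ?_⟩
  have : q = ((t - s)⁻¹ * (t - s)) • q := by rw [inv_mul_cancel₀ hts, one_smul]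
  conv_rhs => rw [this]
  module

lemma zeroSums_neg (f : (σ → ℝ) → ℝ) : zeroSums (fun x => -f x) = zeroSums f := by
  simp [zeroSums]

/-- If the restriction of `F` to a line vanishes to even order at a regular point, then all points
close to the direction of that line are sums of two zeros of `F`. -/
lemma zeroSums_mem_nhds_of_even [Fintype σ] {F : MvPolynomial σ ℝ} {m : ℕ} (hF : F.IsHomogeneous m)
    {x p : σ → ℝ} (hx : eval x F = 0) (hreg : polyDifferential F x ≠ 0)
    (hne : lineRestriction F x p ≠ 0)
    (heven : Even ((lineRestriction F x p).rootMultiplicity 0)) :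
    zeroSums (fun z => eval z F) ∈ 𝓝 p := by
  obtain ⟨g, hg, hg0⟩ := Polynomial.exists_eq_pow_rootMultiplicity_mul_and_not_dvd _ hne 0
  set n := (lineRestriction F x p).rootMultiplicity 0
  rw [Polynomial.dvd_iff_isRoot, Polynomial.IsRoot] at hg0
  have hval : ∀ t : ℝ, eval (x + t • p) F = t ^ n * g.eval t := by
    intro t
    rw [← eval_lineRestriction, hg]
    simp
  have hneg : ∃ᶠ y in 𝓝 x, eval y F < 0 := by
    intro h
    refine hreg (IsLocalMin.hasFDerivAt_eq_zero ?_ (hasFDerivAt_eval F x))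
    filter_upwards [h] with y hy
    simpa [hx] using hy
  have hpos : ∃ᶠ y in 𝓝 x, -eval y F < 0 := by
    intro h
    refine hreg (IsLocalMax.hasFDerivAt_eq_zero ?_ (hasFDerivAt_eval F x))
    filter_upwards [h] with y hy
    simpa [hx] using hy
  have hcone : ∀ (c : ℝ) x, eval x F = 0 → eval (c • x) F = 0 := fun c x h => by
    simp [hF.eval_smul_real, h]
  have hnegt : Tendsto (fun t : ℝ => -t) (𝓝 0) (𝓝 0) := by
    simpa using (continuous_neg (G := ℝ)).tendsto 0
  rcases lt_or_gt_of_ne hg0 with h | h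
  · have hev : ∀ᶠ t in 𝓝 (0 : ℝ), g.eval t < 0 :=
      g.continuous.continuousAt.eventually_lt_const h
    obtain ⟨δ, ⟨hδ₁, hδ₂⟩, hδ⟩ := (((hev.and (hnegt.eventually hev)).filter_mono
      nhdsWithin_le_nhds).and (self_mem_nhdsWithin : Set.Ioi (0 : ℝ) ∈ 𝓝[>] 0)).exists
    rw [← zeroSums_neg]
    refine zeroSums_mem_nhds_of_same_sign (continuous_eval F).neg
      (fun c x h => by simpa using hcone c x (by simpa using h)) hδ ?_ ?_ hpos
    · rw [Pi.neg_apply, hval, neg_pos]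
      exact mul_neg_of_pos_of_neg (pow_pos hδ n) hδ₁
    · rw [Pi.neg_apply, hval, neg_pos, heven.neg_pow]
      exact mul_neg_of_pos_of_neg (pow_pos hδ n) hδ₂
  · have hev : ∀ᶠ t in 𝓝 (0 : ℝ), 0 < g.eval t :=
      g.continuous.continuousAt.eventually_const_lt h
    obtain ⟨δ, ⟨hδ₁, hδ₂⟩, hδ⟩ := (((hev.and (hnegt.eventually hev)).filter_mono
      nhdsWithin_le_nhds).and (self_mem_nhdsWithin : Set.Ioi (0 : ℝ) ∈ 𝓝[>] 0)).exists
    refine zeroSums_mem_nhds_of_same_sign (continuous_eval F) hcone hδ ?_ ?_ hneg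
    · rw [hval]
      exact mul_pos (pow_pos hδ n) hδ₁
    · rw [hval, heven.neg_pow]
      exact mul_pos (pow_pos hδ n) hδ₂

lemma polyDifferential_self [Fintype σ] {F : MvPolynomial σ ℝ} {m : ℕ} (hF : F.IsHomogeneous m)
    {x : σ → ℝ} (hx : eval x F = 0) : polyDifferential F x x = 0 := by
  have h : HasDerivAt (fun s : ℝ => eval (x + s • x) F) (polyDifferential F x x) 0 := by
    simpa using hasDerivAt_eval_line F x x 0
  have h0 : (fun s : ℝ => eval (x + s • x) F) = fun _ => 0 := by
    ext s
    rw [show x + s • x = (1 + s) • x by module, hF.eval_smul_real, hx, mul_zero]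
  rw [h0] at h
  exact h.unique (hasDerivAt_const _ _)

lemma two_le_rootMultiplicity_lineRestriction [Fintype σ] {F : MvPolynomial σ ℝ} {x p : σ → ℝ}
    (hx : eval x F = 0) (hp : polyDifferential F x p = 0) (hne : lineRestriction F x p ≠ 0) :
    2 ≤ (lineRestriction F x p).rootMultiplicity 0 := by
  refine (Polynomial.one_lt_rootMultiplicity_iff_isRoot hne).2 ⟨?_, ?_⟩
  · rw [Polynomial.IsRoot, eval_lineRestriction, zero_smul, add_zero, hx]
  · have h := (lineRestriction F x p).hasDerivAt 0
    simp only [eval_lineRestriction] at h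
    have h' := hasDerivAt_eval_line F x p 0
    rw [zero_smul, add_zero, hp] at h'
    exact h.unique h'

/-- A limit of sums of two zeros of `F` is again such a sum, or lies on the tangent hyperplane of
a nonzero zero. -/
lemma mem_zeroSums_or_tangent_of_mem_closure [Fintype σ] {F : MvPolynomial σ ℝ} {m : ℕ}
    (hF : F.IsHomogeneous m) {p : σ → ℝ} (hp : p ∈ closure (zeroSums (fun z => eval z F))) :
    p ∈ zeroSums (fun z => eval z F) ∨
      ∃ x, x ≠ 0 ∧ eval x F = 0 ∧ polyDifferential F x p = 0 := by
  obtain ⟨q, hq, hqp⟩ := mem_closure_iff_seq_limit.1 hp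
  choose x y hx hy hxy using hq
  beta_reduce at hx hy
  have hFc := continuous_eval F
  by_cases hb : ∃ R : ℝ, ∃ᶠ n in atTop, x n ∈ Metric.closedBall (0 : σ → ℝ) R
  · obtain ⟨R, hR⟩ := hb
    obtain ⟨a, -, φ, hφ, ha⟩ :=
      tendsto_subseq_of_frequently_bounded Metric.isBounded_closedBall hR
    left
    have hqφ := hqp.comp hφ.tendsto_atTop
    refine ⟨a, p - a, ?_, ?_, by abel⟩
    · refine tendsto_nhds_unique ((hFc.tendsto a).comp ha) ?_
      simp [Function.comp_def, hx]
    · refine tendsto_nhds_unique ((hFc.tendsto (p - a)).comp (hqφ.sub ha)) ?_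
      have : ∀ n, q n - x n = y n := fun n => by rw [← hxy n]; abel
      simp [Function.comp_def, this, hy]
  · push Not at hb
    right
    have hinf : Tendsto (fun n => ‖x n‖) atTop atTop := by
      refine tendsto_atTop.2 fun R => ?_
      filter_upwards [hb R] with n hn
      simp at hn
      exact hn.le
    have hpos : ∀ᶠ n in atTop, 0 < ‖x n‖ := hinf.eventually_gt_atTop 0
    obtain ⟨u, hu, φ, hφ, hφu⟩ := (isCompact_sphere (0 : σ → ℝ) 1).tendsto_subseq'
      (x := fun n => ‖x n‖⁻¹ • x n) (hpos.frequently.mono fun n hn => by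
        simp [norm_smul, hn.ne'])
    have hqφ := hqp.comp hφ.tendsto_atTop
    have hs : Tendsto (fun n => ‖x (φ n)‖⁻¹) atTop (𝓝 0) :=
      (tendsto_inv_atTop_zero.comp hinf).comp hφ.tendsto_atTop
    have hu0 : u ≠ 0 := by
      rintro rfl
      simp at hu
    refine ⟨u, hu0, ?_, ?_⟩
    · refine tendsto_nhds_unique ((hFc.tendsto u).comp hφu) ?_
      have : ∀ n, eval (‖x (φ n)‖⁻¹ • x (φ n)) F = 0 := fun n => by
        rw [hF.eval_smul_real, hx, mul_zero]
      simp [Function.comp_def, this]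
    · have hrolle : ∀ n, ∃ c : ℝ, c ∈ Set.Icc 0 ‖x (φ n)‖⁻¹ ∧ (0 < ‖x (φ n)‖ →
          polyDifferential F (‖x (φ n)‖⁻¹ • x (φ n) + c • (-q (φ n))) (-q (φ n)) = 0) := by
        intro n
        rcases (norm_nonneg (x (φ n))).eq_or_lt with h | h
        · exact ⟨0, by simp, fun h' => absurd h h'.ne⟩
        · obtain ⟨c, hc, hc0⟩ := exists_hasDerivAt_eq_zero (inv_pos.2 h)
            (f := fun t : ℝ => eval (‖x (φ n)‖⁻¹ • x (φ n) + t • (-q (φ n))) F)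
            (hFc.comp (by fun_prop)).continuousOn (by
              have : ‖x (φ n)‖⁻¹ • x (φ n) + ‖x (φ n)‖⁻¹ • (-q (φ n))
                  = (-‖x (φ n)‖⁻¹) • y (φ n) := by
                rw [← hxy]; module
              simp only [this, zero_smul, add_zero, hF.eval_smul_real, hx, hy, mul_zero])
            (fun t _ => hasDerivAt_eval_line F _ _ t)
          exact ⟨c, ⟨hc.1.le, hc.2.le⟩, fun _ => hc0⟩
      choose c hc hc0 using hrolle
      have hcl : Tendsto c atTop (𝓝 0) :=
        squeeze_zero (fun n => (hc n).1) (fun n => (hc n).2) hs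
      have hlim := ((continuous_polyDifferential_apply F).tendsto (u + (0 : ℝ) • (-p), -p)).comp
        ((hφu.add (hcl.smul hqφ.neg)).prodMk_nhds hqφ.neg)
      have hz : Tendsto (fun _ : ℕ => (0 : ℝ)) atTop (𝓝 (polyDifferential F
          (u + (0 : ℝ) • (-p)) (-p))) := by
        refine hlim.congr' ?_
        filter_upwards [hφ.tendsto_atTop.eventually hpos] with n hn
        exact hc0 n hn
      have := tendsto_nhds_unique hz tendsto_const_nhds
      simpa using this

end General

section PlaneCurve

variable {F : MvPolynomial (Fin 3) ℝ} {m : ℕ}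

lemma lineRestriction_ne_zero (hm : 2 ≤ m) (hF : F.IsHomogeneous m)
    (hirr : Irreducible (MvPolynomial.map (algebraMap ℝ ℂ) F)) {x p : Fin 3 → ℝ}
    (hxp : LinearIndependent ℝ ![x, p]) : lineRestriction F x p ≠ 0 := by
  intro h0
  have h₁ : ∀ t : ℝ, eval (x + t • p) F = 0 := fun t => by
    rw [← eval_lineRestriction, h0, Polynomial.eval_zero]
  have h₂ : ∀ s t : ℝ, eval (s • x + t • p) F = 0 := by
    intro s t
    have hc : Continuous fun s : ℝ => eval (s • x + t • p) F :=
      (continuous_eval F).comp (by fun_prop)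
    refine congrFun (hc.ext_on (dense_compl_singleton (0 : ℝ)) continuous_const ?_) s
    intro r hr
    have : r • x + t • p = r • (x + (r⁻¹ * t) • p) := by
      rw [smul_add, smul_smul, mul_inv_cancel_left₀ hr]
    simp only [this, hF.eval_smul_real, h₁, mul_zero]
  have hfin : Module.finrank ℝ (Submodule.span ℝ (Set.range ![x, p])) = 2 := by
    simpa using finrank_span_eq_card hxp
  obtain ⟨l, hl, hle⟩ := Submodule.exists_le_ker_of_lt_top (Submodule.span ℝ (Set.range ![x, p]))
    (lt_top_iff_ne_top.2 fun h => by rw [h] at hfin; simp at hfin)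
  have hker : Submodule.span ℝ (Set.range ![x, p]) = LinearMap.ker l := by
    refine Submodule.eq_of_le_of_finrank_eq hle ?_
    have := Module.Dual.finrank_ker_add_one_of_ne_zero hl
    simp at this
    omega
  obtain ⟨L, hL, hdvd⟩ := exists_linear_dvd_of_vanishing F l hl fun y hy => by
    have hy' : y ∈ Submodule.span ℝ (Set.range ![x, p]) := by rw [hker]; exact hy
    rw [Matrix.range_cons, Matrix.range_cons, Matrix.range_empty, Set.union_empty,
      Set.singleton_union, Submodule.mem_span_pair] at hy'
    obtain ⟨a, b, rfl⟩ := hy'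
    exact h₂ a b
  exact not_dvd_linear_of_irreducible_map hm hF hirr hL hdvd

/-- The real zeros of `F` are not contained in a plane. -/
lemma exists_eval_eq_zero_and_apply_ne_zero (hm : 2 ≤ m) (hF : F.IsHomogeneous m)
    (hirr : Irreducible (MvPolynomial.map (algebraMap ℝ ℂ) F)) {x : Fin 3 → ℝ} (hx0 : x ≠ 0)
    (hx : eval x F = 0) (hreg : polyDifferential F x ≠ 0) {l : (Fin 3 → ℝ) →ₗ[ℝ] ℝ} (hl : l ≠ 0) :
    ∃ q, eval q F = 0 ∧ l q ≠ 0 := by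
  by_contra! h
  obtain ⟨v, hv⟩ : ∃ v, polyDifferential F x v ≠ 0 := by
    by_contra! h0
    exact hreg (ContinuousLinearMap.ext h0)
  have hnear := eventually_exists_eval_add_smul_eq_zero hx hv one_pos
  have hline : ∀ w : Fin 3 → ℝ, ∀ᶠ s : ℝ in 𝓝 0, ∃ t : ℝ, |t| < 1 ∧
      eval (x + s • w + t • v) F = 0 := fun w => by
    have hc : Continuous fun s : ℝ => x + s • w := by fun_prop
    have := hc.tendsto 0
    simp only [zero_smul, add_zero] at this
    exact this.eventually hnear
  by_cases hlv : l v = 0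
  · obtain ⟨e, he⟩ : ∃ e, l e ≠ 0 := by
      by_contra! h0
      exact hl (LinearMap.ext h0)
    obtain ⟨s, ⟨t, -, ht⟩, hs⟩ := (((hline e).filter_mono nhdsWithin_le_nhds).and
      (self_mem_nhdsWithin : Set.Ioi (0 : ℝ) ∈ 𝓝[>] 0)).exists
    have := h _ ht
    simp [h x hx, hlv, he] at this
    exact (Set.mem_Ioi.1 hs).ne' this
  · obtain ⟨w, hw, hwx⟩ : ∃ w ∈ LinearMap.ker l, w ∉ Submodule.span ℝ {x} := by
      by_contra! h0
      have h₁ := Submodule.finrank_mono (show LinearMap.ker l ≤ Submodule.span ℝ {x} from h0)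
      rw [finrank_span_singleton hx0] at h₁
      have := Module.Dual.finrank_ker_add_one_of_ne_zero hl
      simp at this
      omega
    have hli : LinearIndependent ℝ ![x, w] :=
      (LinearIndependent.pair_iff' hx0).2 fun a ha => hwx (Submodule.mem_span_singleton.2 ⟨a, ha⟩)
    refine lineRestriction_ne_zero hm hF hirr hli
      (Polynomial.eq_zero_of_infinite_isRoot _ (infinite_of_mem_nhds (0 : ℝ) ?_))
    filter_upwards [hline w] with s ⟨t, _, ht⟩
    have h₁ := h _ ht
    simp [h x hx, LinearMap.mem_ker.1 hw, hlv] at h₁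
    rw [h₁, zero_smul, add_zero] at ht
    simpa [Polynomial.IsRoot, eval_lineRestriction] using ht

lemma exists_sum_three_zeros (hm : 2 ≤ m) (hF : F.IsHomogeneous m)
    (hirr : Irreducible (MvPolynomial.map (algebraMap ℝ ℂ) F)) {x : Fin 3 → ℝ} (hx0 : x ≠ 0)
    (hx : eval x F = 0) (hreg : polyDifferential F x ≠ 0) (p : Fin 3 → ℝ) :
    ∃ y : Fin 3 → Fin 3 → ℝ, (∀ i, eval (y i) F = 0) ∧ ∑ i, y i = p := by
  have hspan : ⊤ ≤ Submodule.span ℝ {x | eval x F = 0} := by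
    by_contra h
    obtain ⟨l, hl, hle⟩ := Submodule.exists_le_ker_of_lt_top _
      (lt_top_iff_ne_top.2 fun h' => h h'.ge)
    obtain ⟨q, hq, hlq⟩ := exists_eval_eq_zero_and_apply_ne_zero hm hF hirr hx0 hx hreg hl
    exact hlq (hle (Submodule.subset_span hq))
  let b := Module.Basis.ofSpan hspan
  let b' := b.reindex (b.indexEquiv (Pi.basisFun ℝ (Fin 3)))
  refine ⟨fun i => b'.repr p i • b' i, fun i => ?_, b'.sum_repr p⟩
  have : eval (b' i) F = 0 := by
    rw [Module.Basis.reindex_apply]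
    exact Module.Basis.ofSpan_subset hspan ⟨_, rfl⟩
  rw [hF.eval_smul_real, this, mul_zero]

lemma zeroSums_mem_nhds_of_tangent (hm : 2 ≤ m) (hF : F.IsHomogeneous m)
    (hirr : Irreducible (MvPolynomial.map (algebraMap ℝ ℂ) F))
    (hreg : ∀ x, eval x F = 0 → x ≠ 0 → polyDifferential F x ≠ 0)
    {p : Fin 3 → ℝ} (hp0 : p ≠ 0)
    (hp : ∀ a, LinearIndependent ℝ ![a, p] → eval a F = 0 →
      Odd ((lineRestriction F a p).rootMultiplicity 0) →
      ¬ 3 ≤ (lineRestriction F a p).rootMultiplicity 0)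
    (h : p ∈ zeroSums (fun z => eval z F) ∨
      ∃ x, x ≠ 0 ∧ eval x F = 0 ∧ polyDifferential F x p = 0) :
    zeroSums (fun z => eval z F) ∈ 𝓝 p := by
  have hcone : eval p F = 0 → zeroSums (fun z => eval z F) ∈ 𝓝 p := by
    intro hpF
    have hpd := hreg p hpF hp0
    obtain ⟨q, hq, hpq⟩ := exists_eval_eq_zero_and_apply_ne_zero hm hF hirr hp0 hpF hpd
      (l := (polyDifferential F p : (Fin 3 → ℝ) →ₗ[ℝ] ℝ))
      (fun h0 => hpd (ContinuousLinearMap.coe_injective h0))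
    simpa using zeroSums_mem_nhds_of_ne_zero hF hpF hq hpq 0
  have htangent : ∀ x, x ≠ 0 → eval x F = 0 → polyDifferential F x p = 0 →
      zeroSums (fun z => eval z F) ∈ 𝓝 p := by
    intro x hx0 hx hxp
    by_cases hli : LinearIndependent ℝ ![x, p]
    · have hne := lineRestriction_ne_zero hm hF hirr hli
      refine zeroSums_mem_nhds_of_even hF hx (hreg x hx hx0) hne ?_
      by_contra hodd
      rw [Nat.not_even_iff_odd] at hodd
      have h2 := two_le_rootMultiplicity_lineRestriction hx hxp hne
      refine hp x hli hx hodd (lt_of_le_of_ne h2 fun h => ?_)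
      rw [← h] at hodd
      exact absurd hodd (by decide)
    · rw [LinearIndependent.pair_iff' hx0] at hli
      push Not at hli
      obtain ⟨c, rfl⟩ := hli
      exact hcone (by rw [hF.eval_smul_real, hx, mul_zero])
  rcases h with ⟨x, y, hx, hy, rfl⟩ | ⟨x, hx0, hx, hxp⟩
  · beta_reduce at hx hy
    rcases eq_or_ne x 0 with rfl | hx0
    · exact hcone (by simpa using hy)
    by_cases hxy : polyDifferential F x y = 0
    · exact htangent x hx0 hx (by rw [map_add, hxy, polyDifferential_self hF hx, add_zero])
    · simpa using zeroSums_mem_nhds_of_ne_zero hF hx hy hxy 1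
  · exact htangent x hx0 hx hxp

lemma realRank_eq_three_iff {S : Set (Fin 3 → ℝ)} (h0 : 0 ∈ S) {p : Fin 3 → ℝ} (hp : p ≠ 0)
    (h3 : ∃ y : Fin 3 → Fin 3 → ℝ, (∀ i, y i ∈ S) ∧ ∑ i, y i = p) :
    realRank S p = 3 ↔ ¬ ∃ x y, x ∈ S ∧ y ∈ S ∧ x + y = p := by
  constructor
  · rintro h ⟨x, y, hx, hy, rfl⟩
    have : realRank S (x + y) ≤ (2 : ℕ) :=
      sInf_le ⟨2, ⟨![x, y], by simp [Fin.forall_fin_two, hx, hy], by simp⟩, rfl⟩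
    rw [h] at this
    exact absurd this (by decide)
  · intro h
    refine le_antisymm (sInf_le ⟨3, h3, rfl⟩) (le_sInf ?_)
    rintro _ ⟨r, ⟨y, hy, hsum⟩, rfl⟩
    by_contra! hr
    have hr' : r < 3 := by exact_mod_cast hr
    interval_cases r
    · exact hp (by simpa using hsum.symm)
    · exact h ⟨y 0, 0, hy 0, h0, by simpa using hsum⟩
    · exact h ⟨y 0, y 1, hy 0, hy 1, by simpa using hsum⟩

end PlaneCurve

/-- For an irreducible plane curve `V(F)` all of whose real points are regular, the set of
points of real rank `3` away from the union `H` of odd-order tangent lines is open and closed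
in the complement of `H ∪ {0}`; i.e., it is a union of connected components. -/
theorem statement16 (F : MvPolynomial (Fin 3) ℝ) (m : ℕ) (hm : 2 ≤ m)
    (hF : F.IsHomogeneous m)
    (hirr : Irreducible (MvPolynomial.map (algebraMap ℝ ℂ) F))
    (Curve : Set (Fin 3 → ℝ)) (hCurve : Curve = {x | eval x F = 0})
    (hne : ∃ x ∈ Curve, x ≠ 0)
    (hreg : ∀ x ∈ Curve, x ≠ 0 → ∃ i, eval x (pderiv i F) ≠ 0)
    (H : Set (Fin 3 → ℝ))
    (hH : H = ⋃ W ∈ {W : Submodule ℝ (Fin 3 → ℝ) | Module.finrank ℝ W = 2 ∧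
        ∃ a b : Fin 3 → ℝ, a ∈ W ∧ b ∈ W ∧ LinearIndependent ℝ ![a, b] ∧ a ∈ Curve ∧
          Odd (Polynomial.rootMultiplicity 0
            (MvPolynomial.aeval
              (fun i => Polynomial.C (a i) + Polynomial.C (b i) * Polynomial.X) F)) ∧
          3 ≤ Polynomial.rootMultiplicity 0
            (MvPolynomial.aeval
              (fun i => Polynomial.C (a i) + Polynomial.C (b i) * Polynomial.X) F)},
      (W : Set (Fin 3 → ℝ))) :
    IsOpen {p : ↥((H ∪ {0})ᶜ) | realRank Curve (p : Fin 3 → ℝ) = 3} ∧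
    IsClosed {p : ↥((H ∪ {0})ᶜ) | realRank Curve (p : Fin 3 → ℝ) = 3} := by
  subst hCurve
  obtain ⟨x₀, hx₀, hx₀0⟩ := hne
  have hreg' : ∀ x, eval x F = 0 → x ≠ 0 → polyDifferential F x ≠ 0 := fun x hx hx0 =>
    (hreg x hx hx0).elim fun _ => polyDifferential_ne_zero
  have hzero : (0 : Fin 3 → ℝ) ∈ {x | eval x F = 0} := by
    have := hF.eval_smul_real 0 x₀
    rwa [zero_smul, hx₀, mul_zero] at this
  set U : Set ↥((H ∪ {0})ᶜ) := {p | (p : Fin 3 → ℝ) ∈ zeroSums (fun z => eval z F)} 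
  have hset : {p : ↥((H ∪ {0})ᶜ) | realRank {x | eval x F = 0} (p : Fin 3 → ℝ) = 3} = Uᶜ := by
    ext ⟨p, hp⟩
    have hp0 : p ≠ 0 := fun h => hp (Or.inr h)
    exact realRank_eq_three_iff hzero hp0
      (exists_sum_three_zeros hm hF hirr hx₀0 hx₀ (hreg' x₀ hx₀ hx₀0) p)
  have hnhds : ∀ p ∈ (H ∪ {0})ᶜ, (p ∈ zeroSums (fun z => eval z F) ∨
      ∃ x, x ≠ 0 ∧ eval x F = 0 ∧ polyDifferential F x p = 0) →
      zeroSums (fun z => eval z F) ∈ 𝓝 p := by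
    intro p hp h
    refine zeroSums_mem_nhds_of_tangent hm hF hirr hreg' (fun h => hp (Or.inr h)) ?_ h
    intro a hli ha hodd h3
    refine hp (Or.inl ?_)
    rw [hH]
    refine Set.mem_biUnion (x := Submodule.span ℝ (Set.range ![a, p])) ⟨?_, a, p, ?_, ?_, hli, ha,
      hodd, h3⟩ ?_
    · simpa using finrank_span_eq_card hli
    · exact Submodule.subset_span ⟨0, rfl⟩
    · exact Submodule.subset_span ⟨1, rfl⟩
    · exact Submodule.subset_span ⟨1, rfl⟩
  rw [hset, isOpen_compl_iff, isClosed_compl_iff]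
  constructor
  · refine isClosed_of_closure_subset fun p hp => ?_
    have hcl : (p : Fin 3 → ℝ) ∈ closure (zeroSums (fun z => eval z F)) :=
      map_mem_closure continuous_subtype_val hp fun _ h => h
    exact mem_of_mem_nhds (s := zeroSums fun z => eval z F)
      (hnhds p p.2 (mem_zeroSums_or_tangent_of_mem_closure hF hcl))
  · exact isOpen_iff_mem_nhds.2 fun p hp =>
      continuous_subtype_val.continuousAt.preimage_mem_nhds (hnhds p p.2 (Or.inl hp))
end
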